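/- arXiv:1612.07786 — 5 statements merged into one kernel-verified Lean document; each statement's English description precedes it below -/
import Mathlib

section
/- Let K be a field with algebraic closure K̄, let F_1, ..., F_s ∈ K[X_1, ..., X_n] form a regular sequence, and let Y_1, ..., Y_n ∈ K[X_1, ..., X_n] be linearly independent linear forms such that, for each 1 ≤ i ≤ s, the variables Y_1, ..., Y_n are in Noether position with respect to the variety V_i := {F_1 = 0, ..., F_i = 0} ⊆ K̄^n (i.e., K[X_1, ..., X_n]/(F_1, ..., F_i) is integral over the polynomial subring K[Y_1, ..., Y_{n−i}]). Then for every p = (p_1, ..., p_{n−s}) ∈ K^{n−s}, the polynomials F_1(p, Y_{n−s+1}, ..., Y_n), ..., F_s(p, Y_{n−s+1}, ..., Y_n), obtained by rewriting each F_i in the coordinates Y_1, ..., Y_n and substituting p_k for Y_k for 1 ≤ k ≤ n − s, form a regular sequence in K[Y_{n−s+1}, ..., Y_n]. -/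
open MvPolynomial

noncomputable section

/-- The `K`-algebra homomorphism `K[Z₁, …, Z_m] → K[X₁, …, Xₙ]/I` sending `Z_i` to the class
of `Y_i`. -/
def coordMap {K : Type*} [Field K] {n m : ℕ} (I : Ideal (MvPolynomial (Fin n) K))
    (Y : Fin m → MvPolynomial (Fin n) K) :
    MvPolynomial (Fin m) K →ₐ[K] (MvPolynomial (Fin n) K ⧸ I) :=
  MvPolynomial.aeval fun i => Ideal.Quotient.mk I (Y i)

/-- `G₁, …, G_s` is a regular sequence of the commutative ring `A`: the ideal
`(G₁, …, G_s)` is proper and each `G_i` is a non-zero-divisor modulo `(G₁, …, G_{i−1})`. -/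
def isRegSeq {A : Type*} [CommRing A] {s : ℕ} (G : Fin s → A) : Prop :=
  Ideal.span (Set.range G) ≠ ⊤ ∧
  ∀ (i : Fin s) (a : A),
    G i * a ∈ Ideal.span (Set.range fun j : Fin (i : ℕ) => G (Fin.castLE i.2.le j)) →
    a ∈ Ideal.span (Set.range fun j : Fin (i : ℕ) => G (Fin.castLE i.2.le j))

/-- Substitution of the values `p₁, …, p_{n−s}` for the first `n − s` variables of a
polynomial in `n` variables, yielding a polynomial in the last `s` variables. -/
def substFirst {K : Type*} [Field K] (n s : ℕ) (hsn : s ≤ n) (p : Fin (n - s) → K)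
    (f : MvPolynomial (Fin n) K) : MvPolynomial (Fin s) K :=
  MvPolynomial.aeval (fun j : Fin n =>
    if h : (j : ℕ) < n - s then MvPolynomial.C (p ⟨(j : ℕ), h⟩)
    else MvPolynomial.X ⟨(j : ℕ) - (n - s), by have := j.2; omega⟩) f

theorem Module.Flat.mem_map_of_algebraMap_mul_mem {B S : Type*} [CommRing B] [CommRing S]
    [Algebra B S] [Module.Flat B S] {I : Ideal B} {g : B} (hg : ∀ u, g * u ∈ I → u ∈ I)
    {y : S} (hy : algebraMap B S g * y ∈ I.map (algebraMap B S)) :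
    y ∈ I.map (algebraMap B S) := by
  obtain ⟨l, a, x, hax⟩ : ∃ (l : ℕ) (a : Fin l → I) (x : Fin l → S),
      algebraMap B S g * y = ∑ i, (a i : B) • x i := by
    obtain ⟨l, c, x, h⟩ := Submodule.mem_span_set'.mp hy
    choose a ha hax using fun i => (x i).2
    refine ⟨l, fun i => ⟨a i, ha i⟩, c, ?_⟩
    rw [← h]
    exact Finset.sum_congr rfl fun i _ => by
      rw [← hax i, smul_eq_mul, Algebra.smul_def, mul_comm]
  obtain ⟨k, b, w, hb, hw⟩ := Module.Flat.isTrivialRelation_of_sum_smul_eq_zero (R := B) (M := S)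
    (f := fun o : Option (Fin l) => o.elim g fun i => -(a i : B))
    (x := fun o => o.elim y x) (by
      simp [Fintype.sum_option, Algebra.smul_def g, hax])
  have hyw : y = ∑ j, b none j • w j := hb none
  rw [hyw]
  refine sum_mem fun j _ => ?_
  rw [Algebra.smul_def]
  refine Ideal.mul_mem_right _ _ (Ideal.mem_map_of_mem _ (hg _ ?_))
  have h := hw j
  simp only [Fintype.sum_option, Option.elim_none, Option.elim_some, neg_mul,
    Finset.sum_neg_distrib, ← sub_eq_add_neg, sub_eq_zero] at h
  rw [h]
  exact sum_mem fun i _ => I.mul_mem_right _ (a i).2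

theorem Polynomial.Monic.mem_map_C_of_mul_mem {A : Type*} [CommRing A] {I : Ideal A}
    {g u : Polynomial A} (hg : g.Monic) (h : g * u ∈ I.map (Polynomial.C : A →+* _)) :
    u ∈ I.map (Polynomial.C : A →+* _) := by
  have key : ∀ v : Polynomial A, v ∈ I.map (Polynomial.C : A →+* _) ↔
      v.map (Ideal.Quotient.mk I) = 0 := fun v => by
    rw [← Polynomial.coe_mapRingHom, ← RingHom.mem_ker, Polynomial.ker_mapRingHom, Ideal.mk_ker]
  rw [key] at h ⊢
  rw [Polynomial.map_mul] at h
  exact (hg.map _).mul_right_eq_zero_iff.mp h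

theorem Module.Flat.quotient_span_singleton {A S : Type*} [CommRing A] [CommRing S] [Algebra A S]
    [Module.Flat A S] {f : S}
    (hf : ∀ (I : Ideal A) (y : S), f * y ∈ I.map (algebraMap A S) → y ∈ I.map (algebraMap A S)) :
    Module.Flat A (S ⧸ Ideal.span {f}) := by
  refine Module.Flat.of_forall_isTrivialRelation fun {l a x} hax => ?_
  choose z hz using fun i => Ideal.Quotient.mk_surjective (x i)
  obtain rfl : (fun i => Ideal.Quotient.mk _ (z i)) = x := funext hz
  have hmem : ∑ i, a i • z i ∈ Ideal.span {f} := by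
    rw [← Ideal.Quotient.eq_zero_iff_mem, map_sum, ← hax]
    rfl
  obtain ⟨y, hy⟩ := Ideal.mem_span_singleton.mp hmem
  have hyI : y ∈ (Ideal.span (Set.range a)).map (algebraMap A S) := by
    refine hf _ y (hy ▸ sum_mem fun i _ => ?_)
    rw [Algebra.smul_def]
    exact Ideal.mul_mem_right _ _ (Ideal.mem_map_of_mem _ (Ideal.subset_span ⟨i, rfl⟩))
  rw [Ideal.map_span, ← Set.range_comp] at hyI
  obtain ⟨c, hc⟩ := Ideal.mem_span_range_iff_exists_fun.mp hyI
  obtain ⟨k, b, w, hb, hw⟩ := Module.Flat.isTrivialRelation_of_sum_smul_eq_zero (R := A) (M := S)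
    (f := a) (x := fun i => z i - f * c i) (by
      simp only [smul_sub, Finset.sum_sub_distrib, hy, ← hc, Finset.mul_sum, sub_eq_zero]
      exact Finset.sum_congr rfl fun i _ => by
        simp only [Function.comp, Algebra.smul_def]; ring)
  refine ⟨k, b, fun j => Ideal.Quotient.mk _ (w j), fun i => ?_, hw⟩
  have h := congrArg (Ideal.Quotient.mk (Ideal.span {f})) (hb i)
  have hf0 : Ideal.Quotient.mk (Ideal.span {f}) f = 0 :=
    Ideal.Quotient.eq_zero_iff_mem.mpr (Ideal.mem_span_singleton_self f)
  rw [map_sub, map_mul, hf0, zero_mul, sub_zero, map_sum] at h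
  exact h

theorem Polynomial.Monic.regular_and_flat_quotient {A S : Type*} [CommRing A] [CommRing S]
    (ψ : Polynomial A →+* S) (hψ : ψ.Flat) {g : Polynomial A} (hg : g.Monic) {f : S}
    (hfg : f ∣ ψ g) :
    (∀ y, f * y = 0 → y = 0) ∧
      ((Ideal.Quotient.mk (Ideal.span {f})).comp (ψ.comp Polynomial.C)).Flat := by
  have hCflat : (Polynomial.C : A →+* Polynomial A).Flat :=
    RingHom.flat_algebraMap_iff.mpr (inferInstance : Module.Flat A (Polynomial A))
  have hcomp := hCflat.comp hψ
  obtain ⟨h, hh⟩ := hfg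
  have hreg : ∀ (I : Ideal A) (y : S), f * y ∈ I.map (ψ.comp Polynomial.C) →
      y ∈ I.map (ψ.comp Polynomial.C) := by
    intro I y hy
    let := ψ.toAlgebra
    have : Module.Flat (Polynomial A) S := hψ
    rw [← Ideal.map_map] at hy ⊢
    refine Module.Flat.mem_map_of_algebraMap_mul_mem (g := g)
      (fun u => hg.mem_map_C_of_mul_mem) ?_
    change ψ g * y ∈ _
    rw [hh, mul_comm f, mul_assoc]
    exact Ideal.mul_mem_left _ _ hy
  refine ⟨fun y hy => by simpa using hreg ⊥ y (by simp [hy]), ?_⟩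
  let := (ψ.comp Polynomial.C).toAlgebra
  have : Module.Flat A S := hcomp
  have := Module.Flat.quotient_span_singleton (A := A) (f := f) hreg
  exact RingHom.flat_algebraMap_iff.mpr this

theorem Polynomial.Monic.regular_and_flat_quotient_sup {A P : Type*} [CommRing A] [CommRing P]
    (J : Ideal P) (ψ : Polynomial A →+* P) (hψ : ((Ideal.Quotient.mk J).comp ψ).Flat)
    {g : Polynomial A} (hg : g.Monic) {f : P} (hfg : ψ g ∈ J ⊔ Ideal.span {f}) :
    (∀ y, f * y ∈ J → y ∈ J) ∧
      ((Ideal.Quotient.mk (J ⊔ Ideal.span {f})).comp (ψ.comp Polynomial.C)).Flat := by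
  obtain ⟨hreg, hflat⟩ := hg.regular_and_flat_quotient ((Ideal.Quotient.mk J).comp ψ) hψ
    (f := Ideal.Quotient.mk J f) (by
      obtain ⟨j, hj, q, hq, hjq⟩ := Submodule.mem_sup.mp hfg
      obtain ⟨r, rfl⟩ := Ideal.mem_span_singleton.mp hq
      refine ⟨Ideal.Quotient.mk J r, ?_⟩
      rw [RingHom.comp_apply, ← hjq, map_add, Ideal.Quotient.eq_zero_iff_mem.mpr hj, zero_add,
        map_mul])
  refine ⟨fun y hy => ?_, ?_⟩
  · rw [← Ideal.Quotient.eq_zero_iff_mem] at hy ⊢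
    exact hreg _ (by rw [← map_mul, hy])
  · have hmap : Ideal.span {Ideal.Quotient.mk J f} =
        (Ideal.span {f}).map (Ideal.Quotient.mk J) := by
      rw [Ideal.map_span, Set.image_singleton]
    let e := (Ideal.quotEquivOfEq hmap).trans (DoubleQuot.quotQuotEquivQuotSup J (Ideal.span {f}))
    exact hflat.comp (RingHom.Flat.of_bijective (f := e.toRingHom) e.bijective)

/-- The variables `X₀, …, X_m` as a polynomial ring in `X_m` over `K[X₀, …, X_{m-1}]`. -/
def polynomialEquivFinSucc (K : Type*) [CommRing K] (m : ℕ) :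
    Polynomial (MvPolynomial (Fin m) K) ≃ₐ[K] MvPolynomial (Fin (m + 1)) K :=
  (optionEquivLeft K (Fin m)).symm.trans (renameEquiv K finSuccEquivLast.symm)

theorem polynomialEquivFinSucc_X (K : Type*) [CommRing K] (m : ℕ) :
    polynomialEquivFinSucc K m Polynomial.X = X (Fin.last m) := by
  simp [polynomialEquivFinSucc, optionEquivLeft_symm_X]

theorem polynomialEquivFinSucc_C {K : Type*} [CommRing K] {m : ℕ} (a : MvPolynomial (Fin m) K) :
    polynomialEquivFinSucc K m (Polynomial.C a) = rename Fin.castSucc a := by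
  induction a using MvPolynomial.induction_on with
  | C a => simp [polynomialEquivFinSucc, optionEquivLeft_symm_C_C]
  | add p q hp hq => simp [hp, hq]
  | mul_X p i hp =>
    rw [map_mul, map_mul, hp, map_mul]
    simp [polynomialEquivFinSucc, optionEquivLeft_symm_C_X]

theorem span_image_lt_succ {A : Type*} [CommRing A] {s : ℕ} (G : Fin s → A) (i : Fin s) :
    Ideal.span (G '' {j | (j : ℕ) < i + 1}) =
      Ideal.span (G '' {j | (j : ℕ) < i}) ⊔ Ideal.span {G i} := by
  rw [← Ideal.span_union, ← Set.image_singleton, ← Set.image_union]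
  congr 2
  ext j
  simp only [Set.mem_ofPred_eq, Set.mem_union, Set.mem_singleton_iff, Fin.ext_iff]
  omega

/-- The subalgebra inclusion `K[X₀, …, X_{m-1}] → K[X₀, …, X_{s-1}]` followed by reduction modulo
the first `i` elements of `G`. -/
def initialQuotientMap {K : Type*} [Field K] {s : ℕ} (G : Fin s → MvPolynomial (Fin s) K)
    (i m : ℕ) (hm : m ≤ s) :
    MvPolynomial (Fin m) K →+* MvPolynomial (Fin s) K ⧸ Ideal.span (G '' {j | (j : ℕ) < i}) :=
  (Ideal.Quotient.mk _).comp (rename (R := K) (Fin.castLE hm)).toRingHom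

theorem regular_and_flat_initialQuotientMap {K : Type*} [Field K] {s : ℕ}
    (G : Fin s → MvPolynomial (Fin s) K) (i : Fin s) (m : ℕ) (hm : m + 1 ≤ s)
    (hflat : (initialQuotientMap G i (m + 1) hm).Flat) {g : Polynomial (MvPolynomial (Fin m) K)}
    (hg : g.Monic)
    (hgG : g.eval₂ (rename (Fin.castLE (Nat.le_of_succ_le hm))).toRingHom
      (X (⟨m, hm⟩ : Fin s)) ∈ Ideal.span (G '' {j | (j : ℕ) < i + 1})) :
    (∀ y, G i * y ∈ Ideal.span (G '' {j | (j : ℕ) < i}) →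
      y ∈ Ideal.span (G '' {j | (j : ℕ) < i})) ∧
    (initialQuotientMap G (i + 1) m (Nat.le_of_succ_le hm)).Flat := by
  let ψ : Polynomial (MvPolynomial (Fin m) K) →+* MvPolynomial (Fin s) K :=
    (rename (R := K) (Fin.castLE hm)).toRingHom.comp
      (polynomialEquivFinSucc K m).toRingEquiv.toRingHom
  have hψC : ψ.comp Polynomial.C =
      (rename (R := K) (Fin.castLE (Nat.le_of_succ_le hm))).toRingHom := by
    refine RingHom.ext fun a => ?_
    change rename _ (polynomialEquivFinSucc K m (Polynomial.C a)) = rename _ a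
    rw [polynomialEquivFinSucc_C, rename_rename]
    rfl
  have hψX : ψ Polynomial.X = X (⟨m, hm⟩ : Fin s) := by
    change rename _ (polynomialEquivFinSucc K m Polynomial.X) = _
    rw [polynomialEquivFinSucc_X, rename_X]
    rfl
  have hψ : ((Ideal.Quotient.mk (Ideal.span (G '' {j | (j : ℕ) < i}))).comp ψ).Flat := by
    rw [← RingHom.comp_assoc]
    exact RingHom.Flat.comp (RingHom.Flat.of_bijective (polynomialEquivFinSucc K m).bijective)
      hflat
  have hψg : ψ g ∈ Ideal.span (G '' {j | (j : ℕ) < i}) ⊔ Ideal.span {G i} := by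
    rw [← span_image_lt_succ]
    convert hgG using 1
    conv_lhs => rw [← Polynomial.eval₂_C_X (p := g)]
    rw [Polynomial.hom_eval₂, hψC, hψX]
  have key := hg.regular_and_flat_quotient_sup _ ψ hψ hψg
  rw [hψC, ← span_image_lt_succ] at key
  exact key

theorem flat_initialQuotientMap {K : Type*} [Field K] {s : ℕ}
    (G : Fin s → MvPolynomial (Fin s) K)
    (hG : ∀ (i : Fin s) (m : ℕ) (hm : i + (m + 1) = s),
      ∃ g : Polynomial (MvPolynomial (Fin m) K), g.Monic ∧
        g.eval₂ (rename (Fin.castLE (by omega : m ≤ s))).toRingHom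
          (X (⟨m, by omega⟩ : Fin s)) ∈ Ideal.span (G '' {j | (j : ℕ) < i + 1}))
    (i m : ℕ) (hm : i + m = s) : (initialQuotientMap G i m (by omega)).Flat := by
  induction i generalizing m with
  | zero =>
    obtain rfl : m = s := by omega
    refine RingHom.Flat.comp (RingHom.Flat.of_bijective ?_) (RingHom.Flat.of_bijective ?_)
    · change Function.Bijective (rename (R := K) id)
      rw [rename_id]
      exact Function.bijective_id
    · have hbot : Ideal.span (G '' {j | (j : ℕ) < 0}) = ⊥ := by simp
      refine ⟨?_, Ideal.Quotient.mk_surjective⟩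
      rw [RingHom.injective_iff_ker_eq_bot, Ideal.mk_ker, hbot]
  | succ i ih =>
    obtain ⟨g, hg, hgG⟩ := hG ⟨i, by omega⟩ m (by dsimp only; omega)
    exact (regular_and_flat_initialQuotientMap G ⟨i, by omega⟩ m (by omega)
      (ih (m + 1) (by omega)) hg hgG).2

theorem RingHom.injective_of_surjective_of_isNoetherianRing {R : Type*} [CommRing R]
    [IsNoetherianRing R] (φ : R →+* R) (hφ : Function.Surjective φ) : Function.Injective φ := by
  obtain ⟨N, hN⟩ := monotone_stabilizes_iff_noetherian.mpr ‹IsNoetherianRing R›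
    ⟨fun k => RingHom.ker (φ ^ k), monotone_nat_of_le_succ fun k x hx => by
      rw [RingHom.mem_ker] at hx ⊢
      rw [pow_succ', RingHom.mul_def, RingHom.comp_apply, hx, map_zero]⟩
  refine (injective_iff_map_eq_zero φ).mpr fun x hx => ?_
  obtain ⟨y, rfl⟩ : ∃ y, (φ ^ N) y = x := by
    rw [RingHom.coe_pow]
    exact hφ.iterate N x
  have hy : y ∈ RingHom.ker (φ ^ (N + 1)) := by
    rwa [RingHom.mem_ker, pow_succ', RingHom.mul_def, RingHom.comp_apply]
  exact (hN (N + 1) N.le_succ).ge hy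

theorem aeval_bijective_of_linearIndependent {K : Type*} [Field K] {n : ℕ}
    {Y : Fin n → MvPolynomial (Fin n) K} (hYhom : ∀ i, (Y i).IsHomogeneous 1)
    (hYind : LinearIndependent K Y) :
    Function.Bijective (aeval Y : MvPolynomial (Fin n) K →ₐ[K] MvPolynomial (Fin n) K) := by
  have hspan : Submodule.span K (Set.range Y) =
      Submodule.span K (Set.range (X : Fin n → MvPolynomial (Fin n) K)) := by
    have := FiniteDimensional.span_of_finite K
      (Set.finite_range (X : Fin n → MvPolynomial (Fin n) K))
    refine Submodule.eq_of_le_of_finrank_le ?_ ?_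
    · rw [Submodule.span_le]
      rintro _ ⟨i, rfl⟩
      rw [← homogeneousSubmodule_one_eq_span_X]
      exact hYhom i
    · rw [finrank_span_eq_card hYind]
      exact finrank_range_le_card _
  have hsurj : Function.Surjective
      (aeval Y : MvPolynomial (Fin n) K →ₐ[K] MvPolynomial (Fin n) K) := by
    rw [← AlgHom.range_eq_top, eq_top_iff, ← adjoin_range_X, Algebra.adjoin_le_iff]
    have hle : Submodule.span K (Set.range Y) ≤
        Subalgebra.toSubmodule (aeval (R := K) Y).range := by
      rw [Submodule.span_le]
      rintro _ ⟨i, rfl⟩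
      exact ⟨X i, aeval_X _ _⟩
    exact fun x hx => hle (hspan ▸ Submodule.subset_span hx)
  exact ⟨(aeval Y).toRingHom.injective_of_surjective_of_isNoetherianRing hsurj, hsurj⟩

theorem range_eq_image_lt {A : Type*} {s i : ℕ} (G : Fin s → A) (hi : i ≤ s) :
    (Set.range fun j : Fin i => G (Fin.castLE hi j)) = G '' {j | (j : ℕ) < i} := by
  ext x
  constructor
  · rintro ⟨j, rfl⟩
    exact ⟨Fin.castLE hi j, j.2, rfl⟩
  · rintro ⟨j, hj, rfl⟩
    exact ⟨⟨j, hj⟩, rfl⟩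

theorem substFirst_X_of_lt {K : Type*} [Field K] {n s : ℕ} (hsn : s ≤ n) (p : Fin (n - s) → K)
    {j : Fin n} (hj : (j : ℕ) < n - s) : substFirst n s hsn p (X j) = C (p ⟨j, hj⟩) := by
  simp [substFirst, hj]

theorem substFirst_X_of_not_lt {K : Type*} [Field K] {n s : ℕ} (hsn : s ≤ n)
    (p : Fin (n - s) → K) {j : Fin n} (hj : ¬ (j : ℕ) < n - s) :
    substFirst n s hsn p (X j) = X ⟨j - (n - s), by omega⟩ := by
  simp [substFirst, hj]

theorem exists_monic_eval₂_mem_map {A B R P : Type*} [CommRing A] [CommRing B] [CommRing R]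
    [CommRing P] (φ : R →+* P) (ν : A →+* R) (ρ : A →+* B) (κ : B →+* P)
    (h : κ.comp ρ = φ.comp ν) (I : Ideal R) (y : R)
    (hy : ((Ideal.Quotient.mk I).comp ν).IsIntegralElem (Ideal.Quotient.mk I y)) :
    ∃ g : Polynomial B, g.Monic ∧ g.eval₂ κ (φ y) ∈ I.map φ := by
  obtain ⟨q, hq, hqy⟩ := hy
  refine ⟨q.map ρ, hq.map _, ?_⟩
  rw [← Polynomial.hom_eval₂, Ideal.Quotient.eq_zero_iff_mem] at hqy
  rw [Polynomial.eval₂_map, h, ← Polynomial.hom_eval₂]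
  exact Ideal.mem_map_of_mem φ hqy

/-- Specialising the first `n - s` coordinates of an integral equation for `Y_{n-s+m}` modulo
`F` yields a monic equation for `X_m` modulo the specialised polynomials. -/
theorem exists_monic_of_isIntegral_coordMap {K : Type*} [Field K] {n s : ℕ} (hsn : s ≤ n)
    {Y : Fin n → MvPolynomial (Fin n) K}
    (hY : Function.Bijective (aeval (R := K) Y : MvPolynomial (Fin n) K →ₐ[K] _))
    {ι : Type*} (Ft : ι → MvPolynomial (Fin n) K) (p : Fin (n - s) → K) {m r : ℕ} (hm : m < s)
    (hr : r = n - s + m)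
    (hint : RingHom.IsIntegral (coordMap (Ideal.span (Set.range fun i => aeval Y (Ft i)))
      (fun k : Fin r => Y ⟨k, by omega⟩)).toRingHom) :
    ∃ g : Polynomial (MvPolynomial (Fin m) K), g.Monic ∧
      g.eval₂ (rename (Fin.castLE hm.le)).toRingHom (X (⟨m, hm⟩ : Fin s)) ∈
        Ideal.span (Set.range fun i => substFirst n s hsn p (Ft i)) := by
  let e : MvPolynomial (Fin n) K ≃ₐ[K] MvPolynomial (Fin n) K := AlgEquiv.ofBijective _ hY
  let σ : MvPolynomial (Fin n) K →ₐ[K] MvPolynomial (Fin s) K := aeval fun j : Fin n =>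
    if h : (j : ℕ) < n - s then C (p ⟨(j : ℕ), h⟩) else X ⟨(j : ℕ) - (n - s), by omega⟩
  let φ : MvPolynomial (Fin n) K →ₐ[K] MvPolynomial (Fin s) K := σ.comp e.symm.toAlgHom
  have hφ : ∀ u, φ (aeval Y u) = substFirst n s hsn p u := fun u =>
    congrArg σ (e.symm_apply_apply u)
  have hφY : ∀ j, φ (Y j) = substFirst n s hsn p (X j) := fun j => by
    rw [← hφ, aeval_X]
  let ρ : MvPolynomial (Fin r) K →ₐ[K] MvPolynomial (Fin m) K := aeval fun k : Fin r =>
    if h : (k : ℕ) < n - s then C (p ⟨(k : ℕ), h⟩) else X ⟨(k : ℕ) - (n - s), by omega⟩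
  let ν : MvPolynomial (Fin r) K →ₐ[K] MvPolynomial (Fin n) K :=
    aeval fun k : Fin r => Y ⟨k, by omega⟩
  have hρν : (rename (Fin.castLE hm.le)).comp ρ = φ.comp ν := by
    refine MvPolynomial.algHom_ext fun k => ?_
    rw [AlgHom.comp_apply, AlgHom.comp_apply, aeval_X, aeval_X, hφY]
    by_cases hk : (k : ℕ) < n - s
    · rw [dif_pos hk, substFirst_X_of_lt hsn p hk, rename_C]
    · rw [dif_neg hk, substFirst_X_of_not_lt hsn p hk, rename_X]
      rfl
  have hcoord : ∀ I : Ideal (MvPolynomial (Fin n) K),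
      (coordMap I fun k : Fin r => Y ⟨k, by omega⟩).toRingHom =
        (Ideal.Quotient.mk I).comp ν.toRingHom := fun I => by
    have : coordMap I (fun k : Fin r => Y ⟨k, by omega⟩) = (Ideal.Quotient.mkₐ K I).comp ν :=
      MvPolynomial.algHom_ext fun k => by simp [coordMap, ν]
    rw [this]
    rfl
  have hXm : φ.toRingHom (Y ⟨n - s + m, by omega⟩) = X (⟨m, hm⟩ : Fin s) := by
    change φ (Y ⟨n - s + m, by omega⟩) = _
    rw [hφY, substFirst_X_of_not_lt hsn p (by simp)]
    simp
  have hrange : (φ.toRingHom ∘ fun i => aeval Y (Ft i)) =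
      fun i => substFirst n s hsn p (Ft i) := by
    funext i
    rw [← hφ]
    rfl
  rw [hcoord] at hint
  have key := exists_monic_eval₂_mem_map φ.toRingHom ν.toRingHom ρ.toRingHom
    (rename (R := K) (Fin.castLE hm.le)).toRingHom (congrArg AlgHom.toRingHom hρν) _ _
    (hint (Ideal.Quotient.mk _ (Y ⟨n - s + m, by omega⟩)))
  rw [Ideal.map_span, ← Set.range_comp, hrange, hXm] at key
  exact key

/-- Lying over the point `p`, the specialised polynomials have a common zero. -/
theorem span_substFirst_ne_top {K : Type*} [Field K] {n s : ℕ} (hsn : s ≤ n)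
    (Y : Fin n → MvPolynomial (Fin n) K)
    {ι : Type*} (Ft : ι → MvPolynomial (Fin n) K) (p : Fin (n - s) → K) {r : ℕ}
    (hr : r = n - s)
    (hinj : Function.Injective (coordMap (Ideal.span (Set.range fun i => aeval Y (Ft i)))
      (fun k : Fin r => Y ⟨k, by omega⟩)))
    (hint : RingHom.IsIntegral (coordMap (Ideal.span (Set.range fun i => aeval Y (Ft i)))
      (fun k : Fin r => Y ⟨k, by omega⟩)).toRingHom) :
    Ideal.span (Set.range fun i => substFirst n s hsn p (Ft i)) ≠ ⊤ := by
  subst hr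
  set I := Ideal.span (Set.range fun i => aeval Y (Ft i)) with hI
  set c := coordMap I (fun k : Fin (n - s) => Y ⟨k, by omega⟩) with hc
  have hker : (RingHom.ker (eval p)).map c.toRingHom ≠ ⊤ := by
    rw [Ne, Ideal.map_eq_top_iff c.toRingHom hinj hint]
    exact RingHom.ker_ne_top _
  set Q := (RingHom.ker (eval p)).map c.toRingHom with hQ
  let π : MvPolynomial (Fin n) K →ₐ[K] (MvPolynomial (Fin n) K ⧸ I) ⧸ Q :=
    (Ideal.Quotient.mkₐ K Q).comp (Ideal.Quotient.mkₐ K I)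
  let τ : MvPolynomial (Fin s) K →ₐ[K] (MvPolynomial (Fin n) K ⧸ I) ⧸ Q :=
    aeval fun j : Fin s => π (Y ⟨n - s + j, by omega⟩)
  let σ : MvPolynomial (Fin n) K →ₐ[K] MvPolynomial (Fin s) K := aeval fun j : Fin n =>
    if h : (j : ℕ) < n - s then C (p ⟨(j : ℕ), h⟩) else X ⟨(j : ℕ) - (n - s), by omega⟩
  have hτ : τ.comp σ = π.comp (aeval Y) := by
    refine MvPolynomial.algHom_ext fun j => ?_
    rw [AlgHom.comp_apply, AlgHom.comp_apply, aeval_X, aeval_X]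
    by_cases hj : (j : ℕ) < n - s
    · rw [dif_pos hj, algHom_C, eq_comm, ← sub_eq_zero]
      have hmem : c (X ⟨j, hj⟩ - C (p ⟨j, hj⟩)) ∈ Q :=
        Ideal.mem_map_of_mem c.toRingHom (by simp [RingHom.mem_ker])
      rw [← Ideal.Quotient.eq_zero_iff_mem, map_sub, map_sub, algHom_C] at hmem
      rw [← hmem]
      congr 1
      simp [hc, coordMap, π]
    · rw [dif_neg hj, aeval_X]
      congr 3
      dsimp only
      omega
  intro htop
  have hle : Ideal.span (Set.range fun i => substFirst n s hsn p (Ft i)) ≤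
      RingHom.ker τ.toRingHom := by
    rw [Ideal.span_le]
    rintro _ ⟨i, rfl⟩
    have h0 : Ideal.Quotient.mk I (aeval Y (Ft i)) = 0 :=
      Ideal.Quotient.eq_zero_iff_mem.mpr (Ideal.subset_span ⟨i, rfl⟩)
    refine (DFunLike.congr_fun hτ (Ft i)).trans ?_
    change Ideal.Quotient.mk Q (Ideal.Quotient.mk I (aeval Y (Ft i))) = 0
    rw [h0, map_zero]
  have : Nontrivial ((MvPolynomial (Fin n) K ⧸ I) ⧸ Q) := Ideal.Quotient.nontrivial_iff.mpr hker
  exact RingHom.ker_ne_top τ.toRingHom (top_le_iff.mp (htop ▸ hle))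

/-- Lemma 4.5 of the paper. -/
theorem stmt_9 {K : Type*} [Field K] (n s : ℕ) (hsn : s ≤ n)
    (F : Fin s → MvPolynomial (Fin n) K)
    (hreg : isRegSeq F)
    (Y : Fin n → MvPolynomial (Fin n) K)
    (hYhom : ∀ i, (Y i).IsHomogeneous 1)
    (hYind : LinearIndependent K Y)
    -- for each `1 ≤ i ≤ s`, `Y₁, …, Yₙ` are in Noether position with respect to
    -- `V_i = {F₁ = 0, …, F_i = 0}`: `K[X]/(F₁, …, F_i)` is integral over the (injectively
    -- embedded) polynomial subring `K[Y₁, …, Y_{n−i}]`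
    (hNoether : ∀ i : Fin s,
      Function.Injective (coordMap
        (Ideal.span (Set.range fun j : Fin ((i : ℕ) + 1) =>
          F ⟨(j : ℕ), by have := j.2; have := i.2; omega⟩))
        (fun k : Fin (n - ((i : ℕ) + 1)) => Y ⟨(k : ℕ), by have := k.2; omega⟩)) ∧
      RingHom.IsIntegral (coordMap
        (Ideal.span (Set.range fun j : Fin ((i : ℕ) + 1) =>
          F ⟨(j : ℕ), by have := j.2; have := i.2; omega⟩))
        (fun k : Fin (n - ((i : ℕ) + 1)) =>
          Y ⟨(k : ℕ), by have := k.2; omega⟩)).toRingHom)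
    -- `Ft i` is `F i` rewritten in the coordinates `Y₁, …, Yₙ`
    (Ft : Fin s → MvPolynomial (Fin n) K)
    (hFt : ∀ i, MvPolynomial.aeval Y (Ft i) = F i)
    (p : Fin (n - s) → K) :
    -- the polynomials `F i (p, Y_{n−s+1}, …, Yₙ)` form a regular sequence
    isRegSeq (fun i => substFirst n s hsn p (Ft i)) := by
  obtain rfl : F = fun i => aeval Y (Ft i) := funext fun i => (hFt i).symm
  have hY := aeval_bijective_of_linearIndependent hYhom hYind
  have hmonic : ∀ (i : Fin s) (m : ℕ) (hm : i + (m + 1) = s),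
      ∃ g : Polynomial (MvPolynomial (Fin m) K), g.Monic ∧
        g.eval₂ (rename (Fin.castLE (by omega : m ≤ s))).toRingHom (X (⟨m, by omega⟩ : Fin s)) ∈
          Ideal.span ((fun i => substFirst n s hsn p (Ft i)) '' {j | (j : ℕ) < i + 1}) := by
    intro i m hm
    rw [← range_eq_image_lt _ i.2]
    exact exists_monic_of_isIntegral_coordMap hsn hY
      (fun j : Fin (i + 1) => Ft ⟨j, by omega⟩) p (by omega) (by omega) (hNoether i).2
  refine ⟨?_, fun i a ha => ?_⟩
  · obtain rfl | hs := Nat.eq_zero_or_pos s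
    · simp
    · have key := span_substFirst_ne_top hsn Y
        (fun j : Fin (s - 1 + 1) => Ft ⟨j, by omega⟩) p (by simp only; omega)
        (hNoether ⟨s - 1, by omega⟩).1 (hNoether ⟨s - 1, by omega⟩).2
      refine ne_top_of_le_ne_top key (Ideal.span_mono ?_)
      rintro _ ⟨j, rfl⟩
      exact ⟨⟨j, by omega⟩, rfl⟩
  · obtain ⟨g, hg, hgG⟩ := hmonic i (s - i - 1) (by omega)
    rw [range_eq_image_lt (fun i => substFirst n s hsn p (Ft i)) i.2.le] at ha ⊢
    exact (regular_and_flat_initialQuotientMap _ i (s - i - 1) (by omega)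
      (flat_initialQuotientMap _ hmonic i _ (by omega)) hg hgG).1 a ha
end
end

section
/- Let K be a perfect field with algebraic closure K̄, V ⊆ K̄^n an equidimensional K-variety of dimension n − s with I(V) = (F_1, ..., F_s), Y_1, ..., Y_{n−s} ∈ K[X_1, ..., X_n] linearly independent linear forms such that π : V → K̄^{n−s}, x ↦ (Y_1(x), ..., Y_{n−s}(x)), is a finite morphism, and R := K[Y_1, ..., Y_{n−s}]. Assume K[V] is a free R-module of finite rank D. Then for every p ∈ K^{n−s}, the fiber π^{−1}(p) ⊆ K̄^n has at most D points, with equality if and only if p is a lifting point of π. -/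
open MvPolynomial

noncomputable section

/-- The zero set, in affine `n`-space over the algebraic closure of `K`, of a set of
polynomials with coefficients in `K`. -/
def mvZeroSet {K : Type*} [Field K] {n : ℕ} (S : Set (MvPolynomial (Fin n) K)) :
    Set (Fin n → AlgebraicClosure K) :=
  {x | ∀ f ∈ S, MvPolynomial.aeval x f = 0}
/-- The vanishing ideal, in `K[X₁, …, Xₙ]`, of a subset of affine `n`-space over the
algebraic closure of `K`. -/
def mvVanishingIdeal {K : Type*} [Field K] {n : ℕ}
    (V : Set (Fin n → AlgebraicClosure K)) : Ideal (MvPolynomial (Fin n) K) :=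
  { carrier := {f | ∀ x ∈ V, MvPolynomial.aeval x f = 0}
    add_mem' := by
      intro a b ha hb x hx
      simp only [Set.mem_setOf_eq] at ha hb ⊢
      simp [map_add, ha x hx, hb x hx]
    zero_mem' := by intro x hx; simp
    smul_mem' := by
      intro c a ha x hx
      simp only [Set.mem_setOf_eq] at ha ⊢
      simp [smul_eq_mul, ha x hx] }
/-- The Jacobian matrix of `Y₁, …, Y_{n-s}, F₁, …, F_s` with respect to `X₁, …, Xₙ`. -/
def jacMat {K : Type*} [Field K] (n s : ℕ) (hsn : s ≤ n)
    (Y : Fin (n - s) → MvPolynomial (Fin n) K) (F : Fin s → MvPolynomial (Fin n) K) :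
    Matrix (Fin n) (Fin n) (MvPolynomial (Fin n) K) :=
  Matrix.of fun i j =>
    if h : (i : ℕ) < n - s then MvPolynomial.pderiv j (Y ⟨(i : ℕ), h⟩)
    else MvPolynomial.pderiv j (F ⟨(i : ℕ) - (n - s), by have h2 := i.2; omega⟩)
/-- The fiber `π⁻¹(p)` of the projection `π : V → 𝔸^m` given by the linear forms `Y`. -/
def fiberSet {K : Type*} [Field K] {n m : ℕ} (V : Set (Fin n → AlgebraicClosure K))
    (Y : Fin m → MvPolynomial (Fin n) K) (p : Fin m → K) :
    Set (Fin n → AlgebraicClosure K) :=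
  {x | x ∈ V ∧ ∀ i, MvPolynomial.aeval x (Y i) = algebraMap K (AlgebraicClosure K) (p i)}
/-- `p` is a lifting point of the projection `π : V → 𝔸^{n-s}` with respect to `F₁, …, F_s`:
the Jacobian determinant of `Y₁, …, Y_{n-s}, F₁, …, F_s` does not vanish at any point of the
fiber `π⁻¹(p)`. -/
def IsLiftingPoint {K : Type*} [Field K] (n s : ℕ) (hsn : s ≤ n)
    (V : Set (Fin n → AlgebraicClosure K))
    (Y : Fin (n - s) → MvPolynomial (Fin n) K) (F : Fin s → MvPolynomial (Fin n) K)
    (p : Fin (n - s) → K) : Prop :=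
  ∀ x ∈ fiberSet V Y p, MvPolynomial.aeval x (jacMat n s hsn Y F).det ≠ 0
/-- `g` is a basis of `K[X₁, …, Xₙ]/I` as a module over `K[Y₁, …, Y_m]`
(acting through `coordMap I Y`). -/
def IsFreeBasisOver {K : Type*} [Field K] {n m D : ℕ} (I : Ideal (MvPolynomial (Fin n) K))
    (Y : Fin m → MvPolynomial (Fin n) K)
    (g : Fin D → MvPolynomial (Fin n) K ⧸ I) : Prop :=
  (∀ b : MvPolynomial (Fin n) K ⧸ I, ∃ c : Fin D → MvPolynomial (Fin m) K,
      b = ∑ i, coordMap I Y (c i) * g i) ∧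
  (∀ c : Fin D → MvPolynomial (Fin m) K, (∑ i, coordMap I Y (c i) * g i) = 0 → ∀ i, c i = 0)

universe u v

theorem card_algHom_eq_finrank_iff_formallyUnramified (L C : Type u) [Field L]
    [IsAlgClosed L] [CommRing C] [Algebra L C] [Module.Finite L C] :
    Nat.card (C →ₐ[L] L) = Module.finrank L C ↔ Algebra.FormallyUnramified L C := by
  have := Fintype.ofFinite (C →ₐ[L] L)
  constructor
  · intro h
    let ev : C →ₐ[L] ((C →ₐ[L] L) → L) := AlgHom.pi fun σ => σ
    have hspan : Submodule.span L
        (Set.range (AlgHom.toLinearMap : (C →ₐ[L] L) → C →ₗ[L] L)) = ⊤ := by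
      have hd : Fintype.card (C →ₐ[L] L) = Module.finrank L (Module.Dual L C) := by
        rw [← Nat.card_eq_fintype_card, h, Subspace.dual_finrank_eq]
      rcases isEmpty_or_nonempty (C →ₐ[L] L) with he | hne
      · have : Subsingleton (Module.Dual L C) := by
          rw [← Module.finrank_zero_iff (R := L), ← hd, Fintype.card_eq_zero]
        exact Subsingleton.elim (α := Submodule L (Module.Dual L C)) _ _
      · exact (linearIndependent_algHom_toLinearMap L C L).span_eq_top_of_card_eq_finrank hd
    have hinj : Function.Injective ev.toLinearMap := by
      rw [← LinearMap.ker_eq_bot, LinearMap.ker_eq_bot']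
      intro c hc
      rw [← Module.forall_dual_apply_eq_zero_iff L]
      intro f
      have hle : Submodule.span L (Set.range (AlgHom.toLinearMap : (C →ₐ[L] L) → C →ₗ[L] L)) ≤
          LinearMap.ker (Module.Dual.eval L C c) := by
        rw [Submodule.span_le]
        rintro _ ⟨σ, rfl⟩
        exact congrFun hc σ
      exact hle (hspan ▸ Submodule.mem_top : f ∈ _)
    have hsurj := (LinearMap.injective_iff_surjective_of_finrank_eq_finrank
      (by rw [← h, Module.finrank_fintype_fun_eq_card, Nat.card_eq_fintype_card])).1 hinj
    exact Algebra.FormallyUnramified.of_equiv (AlgEquiv.ofBijective ev ⟨hinj, hsurj⟩).symm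
  · intro h
    have := Algebra.FormallyEtale.of_formallyUnramified_of_field L C
    have : IsArtinianRing C := IsArtinianRing.of_finite L C
    have := Fintype.ofFinite (PrimeSpectrum C)
    let e := Algebra.FormallyEtale.equivPiOfIsSepClosed L C
    refine le_antisymm (card_algHom_le_finrank L C L) ?_
    rw [e.toLinearEquiv.finrank_eq, Module.finrank_fintype_fun_eq_card, ← Nat.card_eq_fintype_card]
    refine Nat.card_le_card_of_injective
      (fun q => (Pi.evalAlgHom L (fun _ : PrimeSpectrum C => L) q).comp e.toAlgHom) ?_
    classical
    intro q r hqr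
    by_contra hne
    have := DFunLike.congr_fun hqr (e.symm (Pi.single q 1))
    simp [Ne.symm hne] at this

theorem Derivation.map_mvPolynomial_aeval {K C M σ : Type*} [CommRing K] [CommRing C]
    [Algebra K C] [AddCommGroup M] [Module C M] [Module K M] [Fintype σ]
    (d : Derivation K C M) (c : σ → C) (f : MvPolynomial σ K) :
    d (aeval c f) = ∑ i, aeval c (pderiv i f) • d (c i) := by
  classical
  induction f using MvPolynomial.induction_on with
  | C a => simp
  | add p q hp hq => simp [hp, hq, add_smul, Finset.sum_add_distrib]
  | mul_X p j hp =>
    have h (i : σ) : aeval c (pderiv i (p * X j)) =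
        aeval c p * (Pi.single i 1 : σ → C) j + c j * aeval c (pderiv i p) := by
      by_cases hij : j = i <;> simp [pderiv_X, hij, mul_comm]
    simp_rw [h, add_smul, Finset.sum_add_distrib, mul_smul, ← Finset.smul_sum, ← hp]
    simp [Pi.single_apply, ite_smul]

theorem TrivSqZeroExt.fst_mvPolynomial_aeval {K L σ : Type*} [CommRing K] [CommRing L]
    [Algebra K L] (y : σ → TrivSqZeroExt L L) (f : MvPolynomial σ K) :
    (aeval y f).fst = aeval (fun i => (y i).fst) f := by
  have := map_aeval y (TrivSqZeroExt.fstHom K L L).toRingHom f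
  simpa [aeval_def, coe_eval₂Hom, RingHom.comp_assoc] using this

theorem TrivSqZeroExt.snd_mvPolynomial_aeval {K L σ : Type*} [CommRing K] [CommRing L]
    [Algebra K L] [Fintype σ] (y : σ → TrivSqZeroExt L L) (f : MvPolynomial σ K) :
    (aeval y f).snd = ∑ i, aeval (fun i => (y i).fst) (pderiv i f) * (y i).snd := by
  classical
  induction f using MvPolynomial.induction_on with
  | C a => simp [TrivSqZeroExt.algebraMap_eq_inl']
  | add p q hp hq => simp [hp, hq, add_mul, Finset.sum_add_distrib]
  | mul_X p j hp =>
    have h (i : σ) : aeval (fun i => (y i).fst) (pderiv i (p * X j)) =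
        aeval (fun i => (y i).fst) p * (Pi.single i 1 : σ → L) j +
          (y j).fst * aeval (fun i => (y i).fst) (pderiv i p) := by
      by_cases hij : j = i <;> simp [pderiv_X, hij, mul_comm]
    simp_rw [h, add_mul, Finset.sum_add_distrib, mul_assoc, ← Finset.mul_sum, ← hp]
    simp [Pi.single_apply, TrivSqZeroExt.fst_mvPolynomial_aeval, mul_comm, add_comm]

theorem exists_algHom_apply_eq_zero_of_not_isUnit (L : Type*) {C : Type*} [Field L]
    [IsAlgClosed L] [CommRing C] [Algebra L C] [Module.Finite L C] {b : C} (hb : ¬ IsUnit b) :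
    ∃ σ : C →ₐ[L] L, σ b = 0 := by
  obtain ⟨M, hM, hbM⟩ := exists_max_ideal_of_mem_nonunits hb
  let := Ideal.Quotient.field M
  let τ : (C ⧸ M) →ₐ[L] L := IsAlgClosed.lift
  refine ⟨τ.comp (Ideal.Quotient.mkₐ L M), ?_⟩
  simp [Ideal.Quotient.eq_zero_iff_mem.2 hbM]

theorem Matrix.smul_eq_zero_of_sum_smul_eq_zero {C M ι : Type*} [CommRing C] [AddCommGroup M]
    [Module C M] [Fintype ι] [DecidableEq ι] (J : Matrix ι ι C) (w : ι → M)
    (h : ∀ i, ∑ j, J i j • w j = 0) (k : ι) : J.det • w k = 0 := by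
  calc J.det • w k = ∑ j, (J.adjugate * J) k j • w j := by
        simp [Matrix.adjugate_mul, Matrix.one_apply]
    _ = ∑ i, J.adjugate k i • ∑ j, J i j • w j := by
        simp_rw [Matrix.mul_apply, Finset.sum_smul, Finset.smul_sum, mul_smul]
        exact Finset.sum_comm
    _ = 0 := by simp [h]

/-- The Jacobian criterion for a finite algebra over an algebraically closed field which is
generated by the coordinates `c` and universal, for dual number points, among the solutions of the
square system `G i = q i`. -/
theorem formallyUnramified_iff_jacobian_ne_zero {K : Type u} {L C : Type v} [Field K] [Field L]
    [IsAlgClosed L] [Algebra K L] [CommRing C] [Algebra L C] [Algebra K C] [IsScalarTower K L C]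
    [Module.Finite L C] {ι : Type*} [Fintype ι] [DecidableEq ι] (c : ι → C)
    (G : ι → MvPolynomial ι K) (q : ι → K) (hc : Algebra.adjoin L (Set.range c) = ⊤)
    (hG : ∀ i, aeval c (G i) = algebraMap K C (q i))
    (hlift : ∀ y : ι → TrivSqZeroExt L L,
      (∀ i, aeval y (G i) = algebraMap K (TrivSqZeroExt L L) (q i)) →
      ∃ h : C →ₐ[L] TrivSqZeroExt L L, ∀ i, h (c i) = y i)
    (J : Matrix ι ι (MvPolynomial ι K)) (hJ : ∀ i j, J i j = pderiv j (G i)) :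
    Algebra.FormallyUnramified L C ↔
      ∀ σ : C →ₐ[L] L, aeval (fun i => σ (c i)) J.det ≠ 0 := by
  have hσ (σ : C →ₐ[L] L) (f : MvPolynomial ι K) :
      aeval (fun i => σ (c i)) f = σ (aeval c f) :=
    (comp_aeval_apply _ (σ.restrictScalars K) f).symm
  constructor
  · intro hU σ hdet
    have hdet' : (J.map (aeval fun i => σ (c i))).det = 0 := by
      rw [← hdet, AlgHom.map_det]; rfl
    obtain ⟨v, hv, hJv⟩ := Matrix.exists_mulVec_eq_zero_iff.2 hdet'
    let y : ι → TrivSqZeroExt L L := fun i => (σ (c i), v i)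
    obtain ⟨h, hh⟩ := hlift y fun i => by
      ext
      · rw [TrivSqZeroExt.fst_mvPolynomial_aeval]
        change aeval (fun i => σ (c i)) (G i) = algebraMap K L (q i)
        rw [hσ, hG, IsScalarTower.algebraMap_apply K L C, σ.commutes, Algebra.algebraMap_self_apply]
      · rw [TrivSqZeroExt.snd_mvPolynomial_aeval]
        change _ = (0 : L)
        have hi := congrFun hJv i
        simp only [Matrix.mulVec, dotProduct, Matrix.map_apply, hJ] at hi
        exact hi
    have heq : h = (TrivSqZeroExt.inlAlgHom L L L).comp σ := by
      refine Algebra.FormallyUnramified.ext' (TrivSqZeroExt.fstHom L L L).toRingHom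
        ⟨2, TrivSqZeroExt.kerIdeal_sq L L⟩ _ _ fun b => ?_
      have : (TrivSqZeroExt.fstHom L L L).comp h = σ := by
        refine AlgHom.ext_of_adjoin_eq_top hc ?_
        rintro _ ⟨i, rfl⟩
        simp [hh, y]
        rfl
      simpa using DFunLike.congr_fun this b
    refine hv (funext fun i => ?_)
    have := congrArg TrivSqZeroExt.snd ((hh i).symm.trans (DFunLike.congr_fun heq (c i)))
    simpa using! this
  · intro hdet
    have hunit : IsUnit (aeval c J.det) := by
      by_contra hu
      obtain ⟨σ, h0⟩ := exists_algHom_apply_eq_zero_of_not_isUnit L hu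
      exact hdet σ ((hσ σ _).trans h0)
    have hd : KaehlerDifferential.D L C = 0 := by
      refine Derivation.ext_of_adjoin_eq_top _ hc ?_
      rintro _ ⟨k, rfl⟩
      have := Matrix.smul_eq_zero_of_sum_smul_eq_zero (J.map (aeval c))
        (fun j => KaehlerDifferential.D L C (c j)) (fun i => by
          have h1 := ((KaehlerDifferential.D L C).restrictScalars K).map_mvPolynomial_aeval c (G i)
          simp only [Matrix.map_apply, hJ]
          refine h1.symm.trans ?_
          rw [hG, Derivation.map_algebraMap]) k
      have hmap : (J.map (aeval c)).det = aeval c J.det := by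
        rw [AlgHom.map_det]; rfl
      rw [hmap] at this
      exact hunit.smul_eq_zero.1 this
    refine ⟨?_⟩
    rw [← Submodule.subsingleton_iff C, ← subsingleton_iff_bot_eq_top,
      ← KaehlerDifferential.span_range_derivation L C, hd, eq_comm, Submodule.span_eq_bot]
    rintro _ ⟨b, rfl⟩
    rfl

section FiberAlgebra

open TensorProduct


variable {K L B : Type u} [Field K] [Field L] [CommRing B] [Algebra K B]
  {m : ℕ} [Algebra (MvPolynomial (Fin m) K) B] [IsScalarTower K (MvPolynomial (Fin m) K) B]
  [Algebra (MvPolynomial (Fin m) K) L]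

theorem exists_algHom_tensorProduct (T : Type*) [CommRing T] [Algebra K T] [Algebra L T]
    [Algebra (MvPolynomial (Fin m) K) T] [IsScalarTower K (MvPolynomial (Fin m) K) T]
    [IsScalarTower (MvPolynomial (Fin m) K) L T] (f : B →ₐ[K] T)
    (hf : ∀ i, f (algebraMap (MvPolynomial (Fin m) K) B (X i)) =
      algebraMap L T (algebraMap (MvPolynomial (Fin m) K) L (X i))) :
    ∃ h : (L ⊗[MvPolynomial (Fin m) K] B) →ₐ[L] T, ∀ b, h (1 ⊗ₜ b) = f b := by
  have hcomm : f.comp (IsScalarTower.toAlgHom K (MvPolynomial (Fin m) K) B) =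
      IsScalarTower.toAlgHom K (MvPolynomial (Fin m) K) T := by
    refine MvPolynomial.algHom_ext fun i => ?_
    simpa [← IsScalarTower.algebraMap_apply] using hf i
  let fT : B →ₐ[MvPolynomial (Fin m) K] T :=
    { f with commutes' := fun a => DFunLike.congr_fun hcomm a }
  refine ⟨Algebra.TensorProduct.lift (Algebra.ofId L T) fT fun _ _ => Commute.all _ _, ?_⟩
  intro b
  simp [fT]

theorem adjoin_range_one_tmul_eq_top {ι : Type*} (x : ι → B)
    (hx : Algebra.adjoin K (Set.range x) = ⊤) :
    Algebra.adjoin L (Set.range fun i => (1 : L) ⊗ₜ[MvPolynomial (Fin m) K] x i) = ⊤ := by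
  have hB (b : B) : (1 : L) ⊗ₜ[MvPolynomial (Fin m) K] b ∈
      Algebra.adjoin L (Set.range fun i => (1 : L) ⊗ₜ[MvPolynomial (Fin m) K] x i) := by
    have hb : b ∈ Algebra.adjoin K (Set.range x) := hx ▸ Algebra.mem_top
    induction hb using Algebra.adjoin_induction with
    | mem b hb =>
      obtain ⟨i, rfl⟩ := hb
      exact Algebra.subset_adjoin ⟨i, rfl⟩
    | algebraMap r =>
      rw [IsScalarTower.algebraMap_apply K (MvPolynomial (Fin m) K) B, ←
        Algebra.TensorProduct.algebraMap_apply', IsScalarTower.algebraMap_apply _ L]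
      exact Subalgebra.algebraMap_mem _ _
    | add a b _ _ ha hb => rw [TensorProduct.tmul_add]; exact add_mem ha hb
    | mul a b _ _ ha hb =>
      have := mul_mem ha hb
      rwa [Algebra.TensorProduct.tmul_mul_tmul, one_mul] at this
  refine eq_top_iff.2 fun z _ => ?_
  induction z using TensorProduct.induction_on with
  | zero => exact zero_mem _
  | add a b ha hb => exact add_mem (ha trivial) (hb trivial)
  | tmul l b =>
    have := Subalgebra.smul_mem _ (hB b) l
    rwa [TensorProduct.smul_tmul', smul_eq_mul, mul_one] at this

end FiberAlgebra

/-- Counting the solutions of a square polynomial system `G i = q i` whose solution algebra `C` is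
finite: there are at most `finrank L C` of them, with equality exactly when the Jacobian
determinant vanishes at none. -/
theorem ncard_solutions_le_and_eq_iff {K L C : Type u} [Field K] [Field L]
    [IsAlgClosed L] [Algebra K L] [CommRing C] [Algebra L C] [Algebra K C] [IsScalarTower K L C]
    [Module.Finite L C] {ι : Type*} [Fintype ι] [DecidableEq ι] (c : ι → C)
    (G : ι → MvPolynomial ι K) (q : ι → K) (hc : Algebra.adjoin L (Set.range c) = ⊤)
    (hG : ∀ i, aeval c (G i) = algebraMap K C (q i))
    (hlift : ∀ y : ι → TrivSqZeroExt L L,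
      (∀ i, aeval y (G i) = algebraMap K (TrivSqZeroExt L L) (q i)) →
      ∃ h : C →ₐ[L] TrivSqZeroExt L L, ∀ i, h (c i) = y i)
    (J : Matrix ι ι (MvPolynomial ι K)) (hJ : ∀ i j, J i j = pderiv j (G i))
    (Z : Set (ι → L)) (hZ : ∀ x, x ∈ Z ↔ ∀ i, aeval x (G i) = algebraMap K L (q i)) :
    Z.Finite ∧ Z.ncard ≤ Module.finrank L C ∧
      (Z.ncard = Module.finrank L C ↔ ∀ x ∈ Z, aeval x J.det ≠ 0) := by
  have hmem (σ : C →ₐ[L] L) : (fun i => σ (c i)) ∈ Z := by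
    refine (hZ _).2 fun i => ?_
    refine (comp_aeval_apply c (σ.restrictScalars K) (G i)).symm.trans ?_
    rw [hG]
    exact (σ.restrictScalars K).commutes _
  have hbij : Function.Bijective fun σ : C →ₐ[L] L => (⟨_, hmem σ⟩ : Z) := by
    constructor
    · intro σ τ h
      refine AlgHom.ext_of_adjoin_eq_top hc ?_
      rintro _ ⟨i, rfl⟩
      exact congrFun (congrArg Subtype.val h) i
    · rintro ⟨x, hx⟩
      obtain ⟨h, hh⟩ := hlift (fun i => TrivSqZeroExt.inl (x i)) fun i => by
        ext
        · rw [TrivSqZeroExt.fst_mvPolynomial_aeval]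
          exact (hZ x).1 hx i
        · rw [TrivSqZeroExt.snd_mvPolynomial_aeval]
          simp [TrivSqZeroExt.algebraMap_eq_inl']
      refine ⟨(TrivSqZeroExt.fstHom L L L).comp h, Subtype.ext (funext fun i => ?_)⟩
      simp [hh]
  let e := Equiv.ofBijective _ hbij
  have hcard : Z.ncard = Nat.card (C →ₐ[L] L) := (Nat.card_congr e).symm
  refine ⟨Set.finite_coe_iff.1 (Finite.of_equiv _ e), ?_, ?_⟩
  · exact hcard ▸ card_algHom_le_finrank L C L
  · rw [hcard, card_algHom_eq_finrank_iff_formallyUnramified,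
      formallyUnramified_iff_jacobian_ne_zero c G q hc hG hlift J hJ]
    refine ⟨fun h x hx => ?_, fun h σ => h _ (hmem σ)⟩
    obtain ⟨σ, hσ⟩ := hbij.2 ⟨x, hx⟩
    obtain rfl := congrArg Subtype.val hσ
    exact h σ

open scoped TensorProduct

/-- A fiber of a finite free family given by `s` equations `F` in `n`-space over the affine space
with coordinates `Y`: it has at most as many points as the rank, with equality exactly when the
Jacobian determinant vanishes at none of them. -/
theorem ncard_fiber_le_and_eq_iff {K L B : Type u} [Field K] [Field L] [IsAlgClosed L]
    [Algebra K L] [CommRing B] [Algebra K B] (n s D : ℕ) (hsn : s ≤ n)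
    [Algebra (MvPolynomial (Fin (n - s)) K) B] [IsScalarTower K (MvPolynomial (Fin (n - s)) K) B]
    [Algebra (MvPolynomial (Fin (n - s)) K) L] [IsScalarTower K (MvPolynomial (Fin (n - s)) K) L]
    (F : Fin s → MvPolynomial (Fin n) K) (Y : Fin (n - s) → MvPolynomial (Fin n) K)
    (ψ : MvPolynomial (Fin n) K →ₐ[K] B) (hψ : Function.Surjective ψ)
    (hker : RingHom.ker ψ = Ideal.span (Set.range F)) (p : Fin (n - s) → K)
    (hAB : ∀ i, algebraMap (MvPolynomial (Fin (n - s)) K) B (X i) = ψ (Y i))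
    (hAL : ∀ i, algebraMap (MvPolynomial (Fin (n - s)) K) L (X i) = algebraMap K L (p i))
    (g : Fin D → B) (hspan : ∀ b, ∃ c : Fin D → MvPolynomial (Fin (n - s)) K,
      b = ∑ i, algebraMap (MvPolynomial (Fin (n - s)) K) B (c i) * g i)
    (hind : ∀ c : Fin D → MvPolynomial (Fin (n - s)) K,
      ∑ i, algebraMap (MvPolynomial (Fin (n - s)) K) B (c i) * g i = 0 → ∀ i, c i = 0)
    (Z : Set (Fin n → L))
    (hZ : ∀ x, x ∈ Z ↔
      (∀ j, aeval x (F j) = 0) ∧ ∀ j, aeval x (Y j) = algebraMap K L (p j)) :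
    Z.Finite ∧ Z.ncard ≤ D ∧
      (Z.ncard = D ↔ ∀ x ∈ Z, aeval x (jacMat n s hsn Y F).det ≠ 0) := by
  simp_rw [← Algebra.smul_def] at hspan hind
  let b : Module.Basis (Fin D) (MvPolynomial (Fin (n - s)) K) B :=
    .mk (v := g) (Fintype.linearIndependent_iff.2 hind) fun z _ => by
      obtain ⟨c, rfl⟩ := hspan z
      exact sum_mem fun i _ => Submodule.smul_mem _ (c i) (Submodule.subset_span ⟨i, rfl⟩)
  have : Module.Finite (MvPolynomial (Fin (n - s)) K) B := .of_basis b
  have : Module.Free (MvPolynomial (Fin (n - s)) K) B := .of_basis b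
  let x (i : Fin n) : B := ψ (X i)
  have hmk (f : MvPolynomial (Fin n) K) : aeval x f = ψ f := by
    rw [← comp_aeval_apply X ψ, aeval_X_left_apply]
  have hx : Algebra.adjoin K (Set.range x) = ⊤ := by
    rw [Algebra.adjoin_range_eq_range_aeval, AlgHom.range_eq_top]
    intro z
    obtain ⟨f, rfl⟩ := hψ z
    exact ⟨f, hmk f⟩
  let G (i : Fin n) : MvPolynomial (Fin n) K :=
    if h : (i : ℕ) < n - s then Y ⟨i, h⟩ else F ⟨(i : ℕ) - (n - s), by have := i.2; omega⟩
  let q (i : Fin n) : K := if h : (i : ℕ) < n - s then p ⟨i, h⟩ else 0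
  have hsys {T : Type _} [CommRing T] [Algebra K T] (y : Fin n → T) :
      (∀ i, aeval y (G i) = algebraMap K T (q i)) ↔
        (∀ j, aeval y (F j) = 0) ∧ ∀ j, aeval y (Y j) = algebraMap K T (p j) := by
    constructor
    · intro h
      refine ⟨fun j => ?_, fun j => ?_⟩
      · simpa [G, q] using h ⟨n - s + j, by have := j.2; omega⟩
      · simpa [G, q] using h ⟨j, by have := j.2; omega⟩
    · rintro ⟨hF, hY⟩ i
      by_cases h : (i : ℕ) < n - s
      · simp [G, q, h, hY]
      · simp [G, q, h, hF]
  have hrank : Module.finrank L (L ⊗[MvPolynomial (Fin (n - s)) K] B) = D := by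
    rw [Module.finrank_baseChange, Module.finrank_eq_card_basis b, Fintype.card_fin]
  have hF0 (j) : ψ (F j) = 0 :=
    RingHom.mem_ker.1 (hker ▸ Ideal.subset_span ⟨j, rfl⟩)
  have hc (f : MvPolynomial (Fin n) K) :
      aeval (fun i => (1 : L) ⊗ₜ[MvPolynomial (Fin (n - s)) K] x i) f =
      (1 : L) ⊗ₜ[MvPolynomial (Fin (n - s)) K] ψ f := by
    rw [← hmk]
    exact (comp_aeval_apply x
      ((Algebra.TensorProduct.includeRight : B →ₐ[MvPolynomial (Fin (n - s)) K]
        L ⊗[MvPolynomial (Fin (n - s)) K] B).restrictScalars K) f).symm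
  have key := ncard_solutions_le_and_eq_iff (K := K) (L := L)
    (fun i => (1 : L) ⊗ₜ[MvPolynomial (Fin (n - s)) K] x i) G q
    (adjoin_range_one_tmul_eq_top x hx)
    ((hsys _).2 ⟨fun j => by rw [hc, hF0, TensorProduct.tmul_zero], fun j => by
      rw [hc, ← hAB, ← Algebra.TensorProduct.algebraMap_apply',
        IsScalarTower.algebraMap_apply (MvPolynomial (Fin (n - s)) K) L, hAL, ← IsScalarTower.algebraMap_apply K L]⟩)
    (fun y hy => by
      rw [hsys] at hy
      have hI : ∀ f, ψ f = 0 → aeval y f = 0 := by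
        have : RingHom.ker ψ ≤ RingHom.ker (aeval (R := K) y) := by
          rw [hker, Ideal.span_le]
          rintro _ ⟨j, rfl⟩
          exact hy.1 j
        exact this
      let fT : B →ₐ[K] TrivSqZeroExt L L := AlgHom.liftOfSurjective ψ hψ (aeval y) hI
      have hfT (f) : fT (ψ f) = aeval y f := AlgHom.liftOfSurjective_apply ψ hψ _ hI f
      obtain ⟨h, hh⟩ := exists_algHom_tensorProduct (L := L) (TrivSqZeroExt L L) fT fun i => by
        rw [hAB, hAL, ← IsScalarTower.algebraMap_apply K L, ← hy.2 i, hfT]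
      exact ⟨h, fun i => by rw [hh, hfT, aeval_X]⟩)
    (jacMat n s hsn Y F) (fun i j => by
      by_cases h : (i : ℕ) < n - s <;> simp [jacMat, G, h])
    Z (fun y => (hZ y).trans (hsys y).symm)
  rw [hrank] at key
  exact key

/-- Proposition 4.6 of the paper. -/
theorem stmt_10 {K : Type*} [Field K] [PerfectField K] (n s D : ℕ) (hsn : s ≤ n)
    (V : Set (Fin n → AlgebraicClosure K))
    (F : Fin s → MvPolynomial (Fin n) K)
    (hV : V = mvZeroSet (Set.range F))
    (hIV : mvVanishingIdeal V = Ideal.span (Set.range F))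
    (hequi : ∀ P ∈ (mvVanishingIdeal V).minimalPrimes,
      ringKrullDim (MvPolynomial (Fin n) K ⧸ P) = ((n - s : ℕ) : WithBot ℕ∞))
    (Y : Fin (n - s) → MvPolynomial (Fin n) K)
    (hYhom : ∀ i, (Y i).IsHomogeneous 1)
    (hYind : LinearIndependent K Y)
    -- `π : V → K̄^{n−s}` defined by `Y₁, …, Y_{n−s}` is a finite morphism
    (hfin : Function.Injective (coordMap (mvVanishingIdeal V) Y) ∧
      RingHom.IsIntegral (coordMap (mvVanishingIdeal V) Y).toRingHom)
    -- `K[V]` is a free `R`-module of finite rank `D`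
    (hfree : ∃ g : Fin D → MvPolynomial (Fin n) K ⧸ mvVanishingIdeal V,
      IsFreeBasisOver (mvVanishingIdeal V) Y g)
    (p : Fin (n - s) → K) :
    -- the fiber `π⁻¹(p)` has at most `D` points, with equality iff `p` is a lifting point
    (fiberSet V Y p).Finite ∧ (fiberSet V Y p).ncard ≤ D ∧
    ((fiberSet V Y p).ncard = D ↔ IsLiftingPoint n s hsn V Y F p) := by
  obtain ⟨g, hg⟩ := hfree
  let evp : MvPolynomial (Fin (n - s)) K →ₐ[K] AlgebraicClosure K :=
    aeval fun i => algebraMap K (AlgebraicClosure K) (p i)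
  exact @ncard_fiber_le_and_eq_iff K (AlgebraicClosure K) _ _ _ _ _ _ _ n s D hsn
    (coordMap (mvVanishingIdeal V) Y).toRingHom.toAlgebra
    (IsScalarTower.of_algHom (coordMap (mvVanishingIdeal V) Y))
    evp.toRingHom.toAlgebra (IsScalarTower.of_algHom evp) F Y
    (Ideal.Quotient.mkₐ K (mvVanishingIdeal V)) (Ideal.Quotient.mkₐ_surjective K _)
    ((Ideal.Quotient.mkₐ_ker K _).trans hIV) p (fun i => aeval_X _ i) (fun i => aeval_X _ i)
    g hg.1 hg.2 (fiberSet V Y p) (fun x => by rw [hV]; simp [fiberSet, mvZeroSet])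
end
end

section
/- Let K be a perfect field with algebraic closure K̄, V ⊆ K̄^n an equidimensional K-variety of dimension n − s with I(V) = (F_1, ..., F_s), Y_1, ..., Y_{n−s} ∈ K[X_1, ..., X_n] linearly independent linear forms such that π : V → K̄^{n−s} defined by Y_1, ..., Y_{n−s} is a finite morphism, R := K[Y_1, ..., Y_{n−s}], and K[V] a free R-module of finite rank. Then a point p = (p_1, ..., p_{n−s}) ∈ K^{n−s} is a lifting point of π if and only if the ideal J := (F_1, ..., F_s, Y_1 − p_1, ..., Y_{n−s} − p_{n−s}) ⊆ K[X_1, ..., X_n] is radical. -/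
open MvPolynomial

noncomputable section

section JacobianCriterion

variable {K : Type*} [Field K] {σ : Type*} [Fintype σ]

theorem derivation_eq_sum_pderiv_smul {M : Type*} [AddCommGroup M] [Module K M]
    [Module (MvPolynomial σ K) M] [IsScalarTower K (MvPolynomial σ K) M]
    (d : Derivation K (MvPolynomial σ K) M) (f : MvPolynomial σ K) :
    d f = ∑ j, pderiv j f • d (X j) := by
  classical
  induction f using MvPolynomial.induction_on with
  | C a => simp
  | add f g hf hg => simp only [map_add, hf, hg, add_smul, Finset.sum_add_distrib]
  | mul_X f i hf =>
    simp only [Derivation.leibniz, hf, pderiv_X, add_smul, Finset.sum_add_distrib, smul_eq_mul,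
      mul_smul, Finset.smul_sum, Pi.single_apply]
    simp

/-- The Jacobian matrix of a square system of polynomials. -/
def squareJacobian (G : σ → MvPolynomial σ K) : Matrix σ σ (MvPolynomial σ K) :=
  Matrix.of fun i j => pderiv j (G i)

theorem isUnit_mk_of_aeval_ne_zero {L : Type*} [Field L] [Algebra K L] [IsAlgClosed L]
    (I : Ideal (MvPolynomial σ K)) (f : MvPolynomial σ K)
    (h : ∀ x ∈ zeroLocus L I, aeval x f ≠ 0) : IsUnit (Ideal.Quotient.mk I f) := by
  have htop : I ⊔ Ideal.span {f} = ⊤ := by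
    by_contra hne
    obtain ⟨M, hM, hle⟩ := Ideal.exists_le_maximal _ hne
    obtain ⟨x, rfl⟩ := eq_vanishingIdeal_singleton_of_isMaximal L hM
    refine h x (fun g hg => hle (Ideal.mem_sup_left hg) x rfl) ?_
    exact hle (Ideal.mem_sup_right (Ideal.mem_span_singleton_self f)) x rfl
  obtain ⟨a, ha, b, hb, hab⟩ := Submodule.mem_sup.1 ((Ideal.eq_top_iff_one _).1 htop)
  obtain ⟨c, rfl⟩ := Ideal.mem_span_singleton'.1 hb
  refine IsUnit.of_mul_eq_one_right (Ideal.Quotient.mk I c) ?_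
  rw [← map_mul, ← map_one (Ideal.Quotient.mk I), ← hab, map_add,
    Ideal.Quotient.eq_zero_iff_mem.2 ha, zero_add]

variable [DecidableEq σ]

theorem formallyUnramified_of_isUnit_squareJacobian (G : σ → MvPolynomial σ K)
    (h : IsUnit (Ideal.Quotient.mk (Ideal.span (Set.range G)) (squareJacobian G).det)) :
    Algebra.FormallyUnramified K (MvPolynomial σ K ⧸ Ideal.span (Set.range G)) := by
  set I := Ideal.span (Set.range G)
  let d : Derivation K (MvPolynomial σ K) (Ω[(MvPolynomial σ K ⧸ I)⁄K]) :=
    (KaehlerDifferential.D K (MvPolynomial σ K ⧸ I)).compAlgebraMap (MvPolynomial σ K)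
  have hd (f : MvPolynomial σ K) :
      d f = KaehlerDifferential.D K (MvPolynomial σ K ⧸ I) (Ideal.Quotient.mk I f) := rfl
  have hrow (i : σ) : ∑ j, squareJacobian G i j • d (X j) = 0 := by
    have hG : Ideal.Quotient.mk I (G i) = 0 :=
      Ideal.Quotient.eq_zero_iff_mem.2 (Ideal.subset_span ⟨i, rfl⟩)
    simpa [squareJacobian, hd (G i), hG] using (derivation_eq_sum_pderiv_smul d (G i)).symm
  have hdet (k : σ) : (squareJacobian G).det • d (X k) = 0 := by
    calc (squareJacobian G).det • d (X k)
        = ∑ j, ((squareJacobian G).adjugate * squareJacobian G) k j • d (X j) := by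
          simp [Matrix.adjugate_mul, Matrix.smul_apply, Matrix.one_apply]
      _ = ∑ i, (squareJacobian G).adjugate k i • ∑ j, squareJacobian G i j • d (X j) := by
          simp only [Matrix.mul_apply, Finset.sum_smul, Finset.smul_sum, mul_smul]
          exact Finset.sum_comm
      _ = 0 := by simp [hrow]
  have hX (k : σ) : d (X k) = 0 := by
    refine h.smul_eq_zero.1 (Eq.trans ?_ (hdet k))
    exact algebraMap_smul (MvPolynomial σ K ⧸ I) (squareJacobian G).det (d (X k))
  refine ⟨⟨fun a b => ?_⟩⟩
  suffices hs : (⊤ : Submodule (MvPolynomial σ K ⧸ I) Ω[(MvPolynomial σ K ⧸ I)⁄K]) ≤ ⊥ from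
    ((Submodule.mem_bot _).1 (hs (x := a) trivial)).trans
      ((Submodule.mem_bot _).1 (hs (x := b) trivial)).symm
  rw [← KaehlerDifferential.span_range_derivation, Submodule.span_le]
  rintro _ ⟨y, rfl⟩
  obtain ⟨f, rfl⟩ := Ideal.Quotient.mk_surjective y
  rw [← hd, derivation_eq_sum_pderiv_smul d f]
  simp [hX]

theorem isRadical_of_squareJacobian_ne_zero {L : Type*} [Field L] [Algebra K L] [IsAlgClosed L]
    (G : σ → MvPolynomial σ K)
    (h : ∀ x : σ → L, (∀ i, aeval x (G i) = 0) → aeval x (squareJacobian G).det ≠ 0) :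
    (Ideal.span (Set.range G)).IsRadical := by
  have hunit := isUnit_mk_of_aeval_ne_zero (L := L) (Ideal.span (Set.range G))
    (squareJacobian G).det
    fun x hx => h x fun i => hx _ (Ideal.subset_span ⟨i, rfl⟩)
  have := formallyUnramified_of_isUnit_squareJacobian G hunit
  have : Algebra.EssFiniteType K (MvPolynomial σ K ⧸ Ideal.span (Set.range G)) := inferInstance
  exact (Ideal.isRadical_iff_quotient_reduced _).2
    (Algebra.FormallyUnramified.isReduced_of_field K _)

/-- A polynomial killing an element modulo a radical ideal may be taken separable over a perfect
field. -/
theorem exists_separable_aeval_mem_of_isRadical [PerfectField K] {A : Type*} [CommRing A]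
    [Algebra K A] {I : Ideal A} (hI : I.IsRadical) {a : A} {q : Polynomial K} (hq : q ≠ 0)
    (ha : Polynomial.aeval a q ∈ I) :
    ∃ r : Polynomial K, r.Separable ∧ Polynomial.aeval a r ∈ I := by
  classical
  refine ⟨UniqueFactorizationMonoid.radical q,
    PerfectField.separable_iff_squarefree.2 UniqueFactorizationMonoid.squarefree_radical, ?_⟩
  obtain ⟨k, c, hc⟩ := (UniqueFactorizationMonoid.exists_dvd_pow_iff_radical_dvd hq).2 dvd_rfl
  refine hI ⟨k, ?_⟩
  rw [← map_pow, hc, map_mul]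
  exact I.mul_mem_right _ ha

theorem squareJacobian_ne_zero_of_isRadical [PerfectField K] {L : Type*} [Field L] [Algebra K L]
    (G : σ → MvPolynomial σ K) (hrad : (Ideal.span (Set.range G)).IsRadical)
    (halg : ∀ j, ∃ q : Polynomial K, q ≠ 0 ∧
      Polynomial.aeval (X j : MvPolynomial σ K) q ∈ Ideal.span (Set.range G))
    (x : σ → L) (hx : ∀ i, aeval x (G i) = 0) : aeval x (squareJacobian G).det ≠ 0 := by
  intro hdet
  have hdet' : ((aeval x : MvPolynomial σ K →ₐ[K] L).mapMatrix (squareJacobian G)).det = 0 := by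
    rw [← AlgHom.map_det, hdet]
  obtain ⟨v, hv, hmul⟩ := Matrix.exists_mulVec_eq_zero_iff.2 hdet'
  have htangent (f : MvPolynomial σ K) (hf : f ∈ Ideal.span (Set.range G)) :
      aeval x f = 0 ∧ ∑ j, aeval x (pderiv j f) * v j = 0 := by
    induction hf using Submodule.span_induction with
    | mem f hf =>
      obtain ⟨i, rfl⟩ := hf
      exact ⟨hx i, by simpa [Matrix.mulVec, dotProduct, squareJacobian] using congrFun hmul i⟩
    | zero => simp
    | add f g _ _ hf hg => simp [hf.1, hg.1, add_mul, Finset.sum_add_distrib, hf.2, hg.2]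
    | smul c f _ hf =>
      simp only [smul_eq_mul, Derivation.leibniz, map_add, map_mul, hf.1, zero_mul, mul_zero,
        add_zero, mul_assoc, ← Finset.mul_sum, hf.2, and_self]
  refine hv (funext fun j => ?_)
  obtain ⟨q, hq, hqmem⟩ := halg j
  obtain ⟨r, hr, hrmem⟩ := exists_separable_aeval_mem_of_isRadical hrad hq hqmem
  obtain ⟨hzero, hsum⟩ := htangent _ hrmem
  rw [← Polynomial.aeval_algHom_apply, aeval_X] at hzero
  have hne := hr.aeval_derivative_ne_zero hzero
  simp only [Derivation.map_aeval, smul_eq_mul, map_mul, ← Polynomial.aeval_algHom_apply, aeval_X,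
    pderiv_X, mul_assoc] at hsum
  rw [← Finset.mul_sum, Finset.sum_eq_single j] at hsum
  · simpa [hne] using hsum
  · intro b _ hb
    simp [hb.symm]
  · simp

end JacobianCriterion

theorem exists_aeval_mem_of_isIntegral_coordMap {K : Type*} [Field K] {n m : ℕ}
    {I J : Ideal (MvPolynomial (Fin n) K)} (hIJ : I ≤ J) {Y : Fin m → MvPolynomial (Fin n) K}
    {p : Fin m → K} (hJ : ∀ i, Y i - C (p i) ∈ J)
    (hint : (coordMap I Y).toRingHom.IsIntegral) (f : MvPolynomial (Fin n) K) :
    ∃ q : Polynomial K, q ≠ 0 ∧ Polynomial.aeval f q ∈ J := by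
  obtain ⟨r, hr, hroot⟩ := hint (Ideal.Quotient.mk I f)
  refine ⟨r.map (aeval p : MvPolynomial (Fin m) K →ₐ[K] K).toRingHom, (hr.map _).ne_zero, ?_⟩
  have hcomp : (Ideal.Quotient.factorₐ K hIJ).comp (coordMap I Y) =
      (Algebra.ofId K (MvPolynomial (Fin n) K ⧸ J)).comp (aeval p) := by
    refine MvPolynomial.algHom_ext fun i => ?_
    have h : Ideal.Quotient.mk J (Y i) = algebraMap K (MvPolynomial (Fin n) K ⧸ J) (p i) :=
      Ideal.Quotient.eq.2 (hJ i)
    simpa [coordMap, Algebra.ofId_apply] using h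
  rw [← Ideal.Quotient.eq_zero_iff_mem, ← Ideal.Quotient.mkₐ_eq_mk K,
    ← Polynomial.aeval_algHom_apply, Polynomial.aeval_def, Polynomial.eval₂_map]
  have h := congrArg (Ideal.Quotient.factorₐ K hIJ).toRingHom hroot
  rw [Polynomial.hom_eval₂, map_zero] at h
  have hring := congrArg AlgHom.toRingHom hcomp
  exact (congrArg (fun φ => Polynomial.eval₂ φ (Ideal.Quotient.mk J f) r) hring).symm.trans h

/-- The square system `Y₁ - p₁, …, Y_{n-s} - p_{n-s}, F₁, …, F_s` cutting out the fiber over `p`. -/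
def fiberSystem {K : Type*} [Field K] (n s : ℕ) (hsn : s ≤ n)
    (Y : Fin (n - s) → MvPolynomial (Fin n) K) (F : Fin s → MvPolynomial (Fin n) K)
    (p : Fin (n - s) → K) : Fin n → MvPolynomial (Fin n) K := fun i =>
  if h : (i : ℕ) < n - s then Y ⟨i, h⟩ - C (p ⟨i, h⟩)
  else F ⟨(i : ℕ) - (n - s), by have h2 := i.2; omega⟩

theorem squareJacobian_fiberSystem {K : Type*} [Field K] (n s : ℕ) (hsn : s ≤ n)
    (Y : Fin (n - s) → MvPolynomial (Fin n) K) (F : Fin s → MvPolynomial (Fin n) K)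
    (p : Fin (n - s) → K) :
    squareJacobian (fiberSystem n s hsn Y F p) = jacMat n s hsn Y F := by
  ext1 i j
  simp only [squareJacobian, fiberSystem, jacMat, Matrix.of_apply]
  split_ifs <;> simp

theorem range_fiberSystem {K : Type*} [Field K] (n s : ℕ) (hsn : s ≤ n)
    (Y : Fin (n - s) → MvPolynomial (Fin n) K) (F : Fin s → MvPolynomial (Fin n) K)
    (p : Fin (n - s) → K) :
    Set.range (fiberSystem n s hsn Y F p) =
      Set.range F ∪ Set.range fun i => Y i - C (p i) := by
  ext f
  constructor
  · rintro ⟨i, rfl⟩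
    unfold fiberSystem
    split_ifs with h
    · exact Or.inr ⟨_, rfl⟩
    · exact Or.inl ⟨_, rfl⟩
  · rintro (⟨i, rfl⟩ | ⟨i, rfl⟩)
    · refine ⟨⟨n - s + i, by omega⟩, ?_⟩
      simp [fiberSystem]
    · refine ⟨⟨i, by omega⟩, ?_⟩
      simp [fiberSystem]

theorem mem_fiberSet_iff_fiberSystem {K : Type*} [Field K] (n s : ℕ) (hsn : s ≤ n)
    (Y : Fin (n - s) → MvPolynomial (Fin n) K) (F : Fin s → MvPolynomial (Fin n) K)
    (p : Fin (n - s) → K) (x : Fin n → AlgebraicClosure K) :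
    x ∈ fiberSet (mvZeroSet (Set.range F)) Y p ↔
      ∀ i, aeval x (fiberSystem n s hsn Y F p i) = 0 := by
  have h : (∀ i, aeval x (fiberSystem n s hsn Y F p i) = 0) ↔
      ∀ f ∈ Set.range (fiberSystem n s hsn Y F p), aeval x f = 0 := by
    simp only [Set.mem_range, forall_exists_index, forall_apply_eq_imp_iff]
  rw [h, range_fiberSystem]
  simp [fiberSet, mvZeroSet, or_imp, forall_and, sub_eq_zero]

/-- part of Proposition 4.6 of the paper: `p` is a lifting point of `π`
iff the ideal `(F₁, …, F_s, Y₁ − p₁, …, Y_{n−s} − p_{n−s})` is radical. -/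
theorem stmt_11 {K : Type*} [Field K] [PerfectField K] (n s D : ℕ) (hsn : s ≤ n)
    (V : Set (Fin n → AlgebraicClosure K))
    (F : Fin s → MvPolynomial (Fin n) K)
    (hV : V = mvZeroSet (Set.range F))
    (hIV : mvVanishingIdeal V = Ideal.span (Set.range F))
    (hequi : ∀ P ∈ (mvVanishingIdeal V).minimalPrimes,
      ringKrullDim (MvPolynomial (Fin n) K ⧸ P) = ((n - s : ℕ) : WithBot ℕ∞))
    (Y : Fin (n - s) → MvPolynomial (Fin n) K)
    (hYhom : ∀ i, (Y i).IsHomogeneous 1)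
    (hYind : LinearIndependent K Y)
    -- `π : V → K̄^{n−s}` defined by `Y₁, …, Y_{n−s}` is a finite morphism
    (hfin : Function.Injective (coordMap (mvVanishingIdeal V) Y) ∧
      RingHom.IsIntegral (coordMap (mvVanishingIdeal V) Y).toRingHom)
    -- `K[V]` is a free `R`-module of finite rank
    (hfree : ∃ g : Fin D → MvPolynomial (Fin n) K ⧸ mvVanishingIdeal V,
      IsFreeBasisOver (mvVanishingIdeal V) Y g)
    (p : Fin (n - s) → K) :
    IsLiftingPoint n s hsn V Y F p ↔
      (Ideal.span (Set.range F) ⊔ Ideal.span (Set.range fun i : Fin (n - s) =>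
        Y i - MvPolynomial.C (p i))).IsRadical := by
  rw [← Ideal.span_union, ← range_fiberSystem n s hsn Y F p]
  have hlift : IsLiftingPoint n s hsn V Y F p ↔
      ∀ x : Fin n → AlgebraicClosure K, (∀ i, aeval x (fiberSystem n s hsn Y F p i) = 0) →
        aeval x (squareJacobian (fiberSystem n s hsn Y F p)).det ≠ 0 := by
    simp only [IsLiftingPoint, hV, mem_fiberSet_iff_fiberSystem n s hsn,
      squareJacobian_fiberSystem]
  rw [hlift]
  refine ⟨isRadical_of_squareJacobian_ne_zero _, fun hrad => ?_⟩
  refine squareJacobian_ne_zero_of_isRadical _ hrad fun j => ?_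
  refine exists_aeval_mem_of_isIntegral_coordMap (p := p) ?_ (fun i => ?_) hfin.2 (X j)
  · rw [hIV, range_fiberSystem]
    exact Ideal.span_mono Set.subset_union_left
  · rw [range_fiberSystem]
    exact Ideal.subset_span (Or.inr ⟨i, rfl⟩)
end
end

section
/- Let U_1, ..., U_{k+1} be indeterminates over ℤ and let F, G ∈ ℤ[U_1, ..., U_{k+1}] be nonzero polynomials with l := deg_{U_{k+1}} F and m := deg_{U_{k+1}} G. Then the height of the resultant of F and G with respect to U_{k+1} satisfies h(Res_{U_{k+1}}(F, G)) ≤ m·h(F) + l·h(G) + log(k+1)·((m−1)·deg F + l·deg G) + log((l+m)!). -/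
noncomputable section

/-- The height of a multivariate integer polynomial: the base-2 logarithm of the maximum of
the absolute values of its coefficients (with `h(0) = 0`). -/
def mvHeight {σ : Type*} (F : MvPolynomial σ ℤ) : ℝ :=
  Real.logb 2 ((F.support.sup fun d => (MvPolynomial.coeff d F).natAbs : ℕ) : ℝ)

/-- The height of a polynomial in `ℤ[U₁, …, U_k][U_{k+1}]`: the base-2 logarithm of the
maximum of the absolute values of its integer coefficients. -/
def pHeight {k : ℕ} (F : Polynomial (MvPolynomial (Fin k) ℤ)) : ℝ :=
  Real.logb 2 ((F.support.sup fun i =>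
    (F.coeff i).support.sup fun d => (MvPolynomial.coeff d (F.coeff i)).natAbs : ℕ) : ℝ)

/-- The total degree (in all `k + 1` variables) of a polynomial in
`ℤ[U₁, …, U_k][U_{k+1}]`. -/
def pTotalDeg {k : ℕ} (F : Polynomial (MvPolynomial (Fin k) ℤ)) : ℕ :=
  F.support.sup fun i => i + (F.coeff i).totalDegree

/-- The Sylvester matrix of `f` and `g`, of size `g.natDegree + f.natDegree`. -/
def sylvesterMat {R : Type*} [CommRing R] (f g : Polynomial R) :
    Matrix (Fin (g.natDegree + f.natDegree)) (Fin (g.natDegree + f.natDegree)) R :=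
  Matrix.of fun i j =>
    if (i : ℕ) < g.natDegree then
      (if (i : ℕ) ≤ (j : ℕ) ∧ (j : ℕ) ≤ (i : ℕ) + f.natDegree then
        f.coeff ((i : ℕ) + f.natDegree - (j : ℕ)) else 0)
    else
      (if (i : ℕ) - g.natDegree ≤ (j : ℕ) ∧ (j : ℕ) ≤ (i : ℕ) - g.natDegree + g.natDegree then
        g.coeff ((i : ℕ) - g.natDegree + g.natDegree - (j : ℕ)) else 0)

/-- The resultant of two univariate polynomials over a commutative ring: the determinant of
their Sylvester matrix. -/
def resultant {R : Type*} [CommRing R] (f g : Polynomial R) : R :=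
  (sylvesterMat f g).det

/-- At most `(k + 1) ^ D` monomials in `k` variables have degree at most `D`. -/
lemma exists_finset_degree_le (k D : ℕ) :
    ∃ T : Finset (Fin k →₀ ℕ), T.card ≤ (k + 1) ^ D ∧ ∀ d, d.degree ≤ D → d ∈ T := by
  classical
  induction D with
  | zero =>
    refine ⟨{0}, by simp, fun d hd => ?_⟩
    simpa [Finsupp.degree_eq_zero_iff] using hd
  | succ D ih =>
    obtain ⟨T, hT, hmem⟩ := ih
    refine ⟨Finset.image₂ (fun (o : Option (Fin k)) d => o.elim d fun i => Finsupp.single i 1 + d)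
      Finset.univ T, ?_, fun d hd => ?_⟩
    · refine (Finset.card_image₂_le _ _ _).trans ?_
      rw [Finset.card_univ, Fintype.card_option, Fintype.card_fin, pow_succ']
      exact Nat.mul_le_mul_left _ hT
    · rw [Finset.mem_image₂]
      by_cases h0 : d = 0
      · exact ⟨none, Finset.mem_univ _, d, hmem d (by simp [h0]), rfl⟩
      · obtain ⟨i, hi⟩ := Finsupp.ne_iff.mp h0
        have hle : Finsupp.single i 1 ≤ d :=
          Finsupp.single_le_iff.mpr (Nat.one_le_iff_ne_zero.mpr hi)
        have heq : Finsupp.single i 1 + (d - Finsupp.single i 1) = d := add_tsub_cancel_of_le hle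
        refine ⟨some i, Finset.mem_univ _, d - Finsupp.single i 1, hmem _ ?_, heq⟩
        have hdeg := congrArg Finsupp.degree heq
        rw [map_add, Finsupp.degree_single] at hdeg
        omega

lemma card_support_le {k D : ℕ} {p : MvPolynomial (Fin k) ℤ} (hp : p.totalDegree ≤ D) :
    p.support.card ≤ (k + 1) ^ D := by
  obtain ⟨T, hT, hmem⟩ := exists_finset_degree_le k D
  refine (Finset.card_le_card fun d hd => hmem d ?_).trans hT
  exact (MvPolynomial.le_totalDegree hd).trans hp

lemma abs_coeff_mul_le {k D : ℕ} {p q : MvPolynomial (Fin k) ℤ} {H B : ℤ}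
    (hdeg : p.totalDegree ≤ D) (hp : ∀ d, |p.coeff d| ≤ H) (hq : ∀ d, |q.coeff d| ≤ B)
    (d : Fin k →₀ ℕ) : |(p * q).coeff d| ≤ B * (H * ((k : ℤ) + 1) ^ D) := by
  have hH : 0 ≤ H := (abs_nonneg _).trans (hp 0)
  have hB : 0 ≤ B := (abs_nonneg _).trans (hq 0)
  have hcard : (p.support.card : ℤ) ≤ ((k : ℤ) + 1) ^ D := by
    exact_mod_cast card_support_le hdeg
  conv_lhs => rw [p.as_sum, Finset.sum_mul, MvPolynomial.coeff_sum]
  calc _ ≤ ∑ e ∈ p.support, |(MvPolynomial.monomial e (p.coeff e) * q).coeff d| :=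
        Finset.abs_sum_le_sum_abs _ _
    _ ≤ ∑ _e ∈ p.support, H * B := by
        refine Finset.sum_le_sum fun e _ => ?_
        rw [MvPolynomial.coeff_monomial_mul']
        split_ifs
        · rw [abs_mul]
          exact mul_le_mul (hp e) (hq _) (abs_nonneg _) hH
        · simpa using mul_nonneg hH hB
    _ = (H * B) * p.support.card := by rw [Finset.sum_const, nsmul_eq_mul, mul_comm]
    _ ≤ (H * B) * ((k : ℤ) + 1) ^ D := mul_le_mul_of_nonneg_left hcard (mul_nonneg hH hB)
    _ = _ := by ring

lemma abs_coeff_mul_prod_le {k : ℕ} {ι : Type*} {p : ι → MvPolynomial (Fin k) ℤ}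
    {q : MvPolynomial (Fin k) ℤ} {H : ι → ℤ} {D : ι → ℕ} {B : ℤ}
    (hdeg : ∀ i, (p i).totalDegree ≤ D i) (hp : ∀ i d, |(p i).coeff d| ≤ H i)
    (hq : ∀ d, |q.coeff d| ≤ B) (s : Finset ι) (d : Fin k →₀ ℕ) :
    |(q * ∏ i ∈ s, p i).coeff d| ≤ B * ∏ i ∈ s, (H i * ((k : ℤ) + 1) ^ D i) := by
  classical
  induction s using Finset.induction_on generalizing d with
  | empty => simpa using hq d
  | insert i s hi ih =>
    rw [Finset.prod_insert hi, Finset.prod_insert hi, mul_left_comm]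
    refine (abs_coeff_mul_le (hdeg i) (hp i) ih d).trans_eq ?_
    ring

/-- A product of `m` factors of height at most `A` and degree at most `a` and `l` factors of height
at most `B` and degree at most `b`; one of the first `m` factors costs no degree term. -/
lemma abs_coeff_prod_le {k m l a b : ℕ} {A B : ℤ} {p : Fin (m + l) → MvPolynomial (Fin k) ℤ}
    (hdegF : ∀ i : Fin (m + l), (i : ℕ) < m → (p i).totalDegree ≤ a)
    (hF : ∀ i : Fin (m + l), (i : ℕ) < m → ∀ d, |(p i).coeff d| ≤ A)
    (hdegG : ∀ i : Fin (m + l), ¬ (i : ℕ) < m → (p i).totalDegree ≤ b)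
    (hG : ∀ i : Fin (m + l), ¬ (i : ℕ) < m → ∀ d, |(p i).coeff d| ≤ B)
    (d : Fin k →₀ ℕ) :
    |(∏ i, p i).coeff d| ≤ A ^ m * B ^ l * ((k : ℤ) + 1) ^ ((m - 1) * a + l * b) := by
  classical
  set H : Fin (m + l) → ℤ := fun i => if (i : ℕ) < m then A else B with hHdef
  set D : Fin (m + l) → ℕ := fun i => if (i : ℕ) < m then a else b with hDdef
  have hdeg : ∀ i, (p i).totalDegree ≤ D i := fun i => by
    by_cases h : (i : ℕ) < m
    · simpa [hDdef, h] using hdegF i h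
    · simpa [hDdef, h] using hdegG i h
  have hp : ∀ i d, |(p i).coeff d| ≤ H i := fun i d => by
    by_cases h : (i : ℕ) < m
    · simpa [hHdef, h] using hF i h d
    · simpa [hHdef, h] using hG i h d
  have hprod : ∏ i, (H i * ((k : ℤ) + 1) ^ D i) =
      (A * ((k : ℤ) + 1) ^ a) ^ m * (B * ((k : ℤ) + 1) ^ b) ^ l := by
    rw [Fin.prod_univ_add]
    simp [hHdef, hDdef]
  rcases Nat.eq_zero_or_pos m with hm | hm
  · have h1 : ∀ d, |(1 : MvPolynomial (Fin k) ℤ).coeff d| ≤ 1 := fun d => by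
      rw [MvPolynomial.coeff_one]
      split_ifs <;> simp
    have := abs_coeff_mul_prod_le hdeg hp h1 Finset.univ d
    rw [one_mul, one_mul, hprod] at this
    refine this.trans_eq ?_
    simp only [hm]
    ring
  · let i₀ : Fin (m + l) := ⟨0, by omega⟩
    have hi₀ : (i₀ : ℕ) < m := hm
    have key := abs_coeff_mul_prod_le hdeg hp (hp i₀) (Finset.univ.erase i₀) d
    rw [Finset.mul_prod_erase _ _ (Finset.mem_univ i₀)] at key
    refine key.trans_eq ?_
    have hpos : (0 : ℤ) < ((k : ℤ) + 1) ^ a := by positivity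
    refine mul_left_cancel₀ hpos.ne' ?_
    have hsplit := Finset.mul_prod_erase Finset.univ (fun i => H i * ((k : ℤ) + 1) ^ D i)
      (Finset.mem_univ i₀)
    rw [hprod] at hsplit
    have hH0 : H i₀ = A := if_pos hi₀
    have hD0 : D i₀ = a := if_pos hi₀
    simp only [hH0, hD0] at hsplit ⊢
    obtain ⟨n, rfl⟩ : ∃ n, m = n + 1 := ⟨m - 1, by omega⟩
    rw [← mul_assoc, mul_comm (_ ^ a) A, hsplit, Nat.add_sub_cancel]
    ring

/-- The largest absolute value of the integer coefficients of `F`. -/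
def maxCoeff {k : ℕ} (F : Polynomial (MvPolynomial (Fin k) ℤ)) : ℕ :=
  F.support.sup fun i =>
    (F.coeff i).support.sup fun d => (MvPolynomial.coeff d (F.coeff i)).natAbs

lemma abs_coeff_coeff_le {k : ℕ} (F : Polynomial (MvPolynomial (Fin k) ℤ)) (i : ℕ)
    (d : Fin k →₀ ℕ) : |(F.coeff i).coeff d| ≤ (maxCoeff F : ℤ) := by
  by_cases hd : (F.coeff i).coeff d = 0
  · simp [hd]
  have hi : F.coeff i ≠ 0 := fun h => hd (by simp [h])
  have h₁ : ((F.coeff i).coeff d).natAbs ≤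
      (F.coeff i).support.sup fun d => (MvPolynomial.coeff d (F.coeff i)).natAbs :=
    Finset.le_sup (f := fun d => (MvPolynomial.coeff d (F.coeff i)).natAbs)
      (MvPolynomial.mem_support_iff.mpr hd)
  have h₂ : ((F.coeff i).support.sup fun d => (MvPolynomial.coeff d (F.coeff i)).natAbs) ≤
      maxCoeff F :=
    Finset.le_sup (f := fun i => (F.coeff i).support.sup fun d =>
      (MvPolynomial.coeff d (F.coeff i)).natAbs) (Polynomial.mem_support_iff.mpr hi)
  rw [Int.abs_eq_natAbs]
  exact_mod_cast h₁.trans h₂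

lemma maxCoeff_pos {k : ℕ} {F : Polynomial (MvPolynomial (Fin k) ℤ)} (hF : F ≠ 0) :
    0 < maxCoeff F := by
  obtain ⟨d, hd⟩ := MvPolynomial.ne_zero_iff.mp (Polynomial.leadingCoeff_ne_zero.mpr hF)
  exact_mod_cast (abs_pos.mpr hd).trans_le (abs_coeff_coeff_le F F.natDegree d)

lemma totalDegree_coeff_le {k : ℕ} (F : Polynomial (MvPolynomial (Fin k) ℤ)) (i : ℕ) :
    (F.coeff i).totalDegree ≤ pTotalDeg F := by
  by_cases hi : F.coeff i = 0
  · simp [hi]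
  · exact (Nat.le_add_left _ i).trans
      (Finset.le_sup (f := fun i => i + (F.coeff i).totalDegree)
        (Polynomial.mem_support_iff.mpr hi))

lemma abs_coeff_resultant_le {k : ℕ} (F G : Polynomial (MvPolynomial (Fin k) ℤ))
    (d : Fin k →₀ ℕ) :
    |(resultant F G).coeff d| ≤ ((maxCoeff F ^ G.natDegree * maxCoeff G ^ F.natDegree *
      (k + 1) ^ ((G.natDegree - 1) * pTotalDeg F + F.natDegree * pTotalDeg G) *
      (F.natDegree + G.natDegree).factorial : ℕ) : ℤ) := by
  rw [resultant, ← Matrix.det_transpose, Matrix.det_apply, MvPolynomial.coeff_sum]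
  refine (Finset.abs_sum_le_sum_abs _ _).trans ?_
  have hterm : ∀ σ : Equiv.Perm (Fin (G.natDegree + F.natDegree)),
      |(Equiv.Perm.sign σ • ∏ i, (sylvesterMat F G).transpose (σ i) i).coeff d| ≤
      (maxCoeff F : ℤ) ^ G.natDegree * (maxCoeff G : ℤ) ^ F.natDegree *
      ((k : ℤ) + 1) ^ ((G.natDegree - 1) * pTotalDeg F + F.natDegree * pTotalDeg G) := by
    intro σ
    have hsign : |(Equiv.Perm.sign σ • ∏ i, (sylvesterMat F G).transpose (σ i) i).coeff d| =
        |(∏ i, sylvesterMat F G i (σ i)).coeff d| := by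
      rcases Int.units_eq_one_or (Equiv.Perm.sign σ) with h | h <;>
        simp [h, Units.smul_def, Matrix.transpose_apply]
    rw [hsign]
    apply abs_coeff_prod_le
    · intro i hi
      simp only [sylvesterMat, Matrix.of_apply, if_pos hi]
      split_ifs
      · exact totalDegree_coeff_le _ _
      · simp
    · intro i hi e
      simp only [sylvesterMat, Matrix.of_apply, if_pos hi]
      split_ifs
      · exact abs_coeff_coeff_le _ _ _
      · simp
    · intro i hi
      simp only [sylvesterMat, Matrix.of_apply, if_neg hi]
      split_ifs
      · exact totalDegree_coeff_le _ _
      · simp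
    · intro i hi e
      simp only [sylvesterMat, Matrix.of_apply, if_neg hi]
      split_ifs
      · exact abs_coeff_coeff_le _ _ _
      · simp
  refine (Finset.sum_le_sum fun σ _ => hterm σ).trans_eq ?_
  rw [Finset.sum_const, Finset.card_univ, Fintype.card_perm, Fintype.card_fin, nsmul_eq_mul,
    add_comm G.natDegree]
  push_cast
  ring

lemma mvHeight_le_logb {σ : Type*} {P : MvPolynomial σ ℤ} {N : ℕ} (hN : 0 < N)
    (h : ∀ d, |P.coeff d| ≤ (N : ℤ)) : mvHeight P ≤ Real.logb 2 N := by
  have hle : (P.support.sup fun d => (MvPolynomial.coeff d P).natAbs) ≤ N :=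
    Finset.sup_le fun d _ => by
      have := h d
      rw [Int.abs_eq_natAbs] at this
      exact_mod_cast this
  unfold mvHeight
  rcases Nat.eq_zero_or_pos (P.support.sup fun d => (MvPolynomial.coeff d P).natAbs) with h0 | h0
  · rw [h0, Nat.cast_zero, Real.logb_zero]
    exact Real.logb_nonneg one_lt_two (by exact_mod_cast hN)
  · exact Real.logb_le_logb_of_le one_lt_two (by exact_mod_cast h0) (by exact_mod_cast hle)

/-- Lemma A.3 of the paper.  For nonzero `F, G ∈ ℤ[U₁, …, U_{k+1}]`
(written as univariate polynomials in `U_{k+1}` over `ℤ[U₁, …, U_k]`) with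
`l = deg_{U_{k+1}} F` and `m = deg_{U_{k+1}} G`,
`h(Res(F, G)) ≤ m·h(F) + l·h(G) + log(k+1)·((m−1)·deg F + l·deg G) + log((l+m)!)`. -/
theorem stmt_13 (k : ℕ) (F G : Polynomial (MvPolynomial (Fin k) ℤ))
    (hF : F ≠ 0) (hG : G ≠ 0) :
    mvHeight (resultant F G) ≤
      (G.natDegree : ℝ) * pHeight F + (F.natDegree : ℝ) * pHeight G +
      Real.logb 2 (k + 1) *
        (((G.natDegree - 1 : ℕ) : ℝ) * (pTotalDeg F : ℝ) +
          (F.natDegree : ℝ) * (pTotalDeg G : ℝ)) +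
      Real.logb 2 ((F.natDegree + G.natDegree).factorial : ℝ) := by
  have hA := maxCoeff_pos hF
  have hB := maxCoeff_pos hG
  refine (mvHeight_le_logb (by positivity) (abs_coeff_resultant_le F G)).trans_eq ?_
  have hA' : (maxCoeff F : ℝ) ≠ 0 := by exact_mod_cast hA.ne'
  have hB' : (maxCoeff G : ℝ) ≠ 0 := by exact_mod_cast hB.ne'
  have hk : (k : ℝ) + 1 ≠ 0 := by positivity
  have hfac : ((F.natDegree + G.natDegree).factorial : ℝ) ≠ 0 := by positivity
  rw [show pHeight F = Real.logb 2 (maxCoeff F) from rfl,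
    show pHeight G = Real.logb 2 (maxCoeff G) from rfl]
  rw [Nat.cast_mul, Nat.cast_mul, Nat.cast_mul, Nat.cast_pow, Nat.cast_pow, Nat.cast_pow,
    Nat.cast_succ,
    Real.logb_mul (by positivity) hfac, Real.logb_mul (by positivity) (by positivity),
    Real.logb_mul (by positivity) (by positivity), Real.logb_pow, Real.logb_pow, Real.logb_pow]
  push_cast
  ring
end
end

section
/- Let F_1, ..., F_s ∈ ℤ[X_1, ..., X_n] be polynomials of total degree at most d ≥ 2 and height at most h, and let λ_{ij} ∈ ℤ for 1 ≤ i ≤ n − s, 1 ≤ j ≤ n be integers with h(λ_{ij}) ≤ H for all i, j. Set Y_i := Σ_{j=1}^n λ_{ij} X_j for 1 ≤ i ≤ n − s, and let J_s be the Jacobian determinant of Y_1, ..., Y_{n−s}, F_1, ..., F_s with respect to X_1, ..., X_n (the determinant of the n × n matrix whose first n − s rows are the gradients of the Y_i and whose last s rows are the gradients of the F_i). Then deg J_s ≤ s(d − 1) and h(J_s) ≤ s(log d + h) + (n − s)H + s·d·log(n+1) + log(n!). -/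
noncomputable section

open MvPolynomial

/-- The sum of the absolute values of the coefficients of an integer polynomial. -/
def coeffNorm {σ : Type*} (p : MvPolynomial σ ℤ) : ℝ :=
  ∑ m ∈ p.support, |((coeff m p : ℤ) : ℝ)|

section CoeffNorm

variable {σ : Type*}

lemma coeffNorm_eq_sum_of_subset {p : MvPolynomial σ ℤ} {S : Finset (σ →₀ ℕ)}
    (hS : p.support ⊆ S) : coeffNorm p = ∑ m ∈ S, |((coeff m p : ℤ) : ℝ)| :=
  Finset.sum_subset hS fun m _ hm => by simp [notMem_support_iff.1 hm]

lemma coeffNorm_nonneg (p : MvPolynomial σ ℤ) : 0 ≤ coeffNorm p :=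
  Finset.sum_nonneg fun _ _ => abs_nonneg _

lemma coeffNorm_zero : coeffNorm (0 : MvPolynomial σ ℤ) = 0 := by simp [coeffNorm]

lemma coeffNorm_neg (p : MvPolynomial σ ℤ) : coeffNorm (-p) = coeffNorm p := by
  simp [coeffNorm]

lemma coeffNorm_monomial (m : σ →₀ ℕ) (a : ℤ) : coeffNorm (monomial m a) = |(a : ℝ)| := by
  classical
  rw [coeffNorm_eq_sum_of_subset support_monomial_subset]
  simp [coeff_monomial]

lemma coeffNorm_add_le (p q : MvPolynomial σ ℤ) :
    coeffNorm (p + q) ≤ coeffNorm p + coeffNorm q := by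
  classical
  rw [coeffNorm_eq_sum_of_subset (support_add (p := p) (q := q)),
    coeffNorm_eq_sum_of_subset (Finset.subset_union_left (s₁ := p.support) (s₂ := q.support)),
    coeffNorm_eq_sum_of_subset (Finset.subset_union_right (s₁ := p.support) (s₂ := q.support)),
    ← Finset.sum_add_distrib]
  refine Finset.sum_le_sum fun m _ => ?_
  rw [coeff_add, Int.cast_add]
  exact abs_add_le _ _

lemma coeffNorm_sum_le {ι : Type*} (S : Finset ι) (f : ι → MvPolynomial σ ℤ) :
    coeffNorm (∑ i ∈ S, f i) ≤ ∑ i ∈ S, coeffNorm (f i) :=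
  Finset.le_sum_of_subadditive coeffNorm coeffNorm_zero.le coeffNorm_add_le S f

lemma coeffNorm_mul_le (p q : MvPolynomial σ ℤ) :
    coeffNorm (p * q) ≤ coeffNorm p * coeffNorm q := by
  conv_lhs => rw [p.as_sum, q.as_sum, Finset.sum_mul_sum]
  simp only [monomial_mul]
  refine (coeffNorm_sum_le _ _).trans ?_
  rw [coeffNorm, coeffNorm, Finset.sum_mul_sum]
  refine Finset.sum_le_sum fun m _ => (coeffNorm_sum_le _ _).trans ?_
  simp [coeffNorm_monomial, abs_mul]

lemma coeffNorm_prod_le {ι : Type*} (S : Finset ι) (f : ι → MvPolynomial σ ℤ) :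
    coeffNorm (∏ i ∈ S, f i) ≤ ∏ i ∈ S, coeffNorm (f i) := by
  classical
  induction S using Finset.induction_on with
  | empty => simpa using (coeffNorm_monomial (0 : σ →₀ ℕ) 1).le
  | insert i S hi ih =>
    rw [Finset.prod_insert hi, Finset.prod_insert hi]
    exact (coeffNorm_mul_le _ _).trans (mul_le_mul_of_nonneg_left ih (coeffNorm_nonneg _))

lemma pderiv_eq_sum (j : σ) (p : MvPolynomial σ ℤ) :
    pderiv j p = ∑ m ∈ p.support, monomial (m - Finsupp.single j 1) (coeff m p * m j) := by
  conv_lhs => rw [p.as_sum]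
  simp only [map_sum, pderiv_monomial]

lemma coeffNorm_pderiv_le {d : ℕ} {p : MvPolynomial σ ℤ} (hp : p.totalDegree ≤ d) (j : σ) :
    coeffNorm (pderiv j p) ≤ d * coeffNorm p := by
  rw [pderiv_eq_sum, coeffNorm.eq_def p, Finset.mul_sum]
  refine (coeffNorm_sum_le _ _).trans (Finset.sum_le_sum fun m hm => ?_)
  have hmd : m j ≤ d :=
    (monomial_le_degreeOf j hm).trans ((degreeOf_le_totalDegree p j).trans hp)
  rw [coeffNorm_monomial, Int.cast_mul, abs_mul, mul_comm]
  gcongr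
  simpa using hmd

lemma totalDegree_pderiv_le (j : σ) (p : MvPolynomial σ ℤ) :
    (pderiv j p).totalDegree ≤ p.totalDegree - 1 := by
  rw [pderiv_eq_sum]
  refine totalDegree_finsetSum_le fun m hm => ?_
  by_cases hj : m j = 0
  · simp [hj]
  refine (totalDegree_monomial_le _ _).trans ?_
  have hle : Finsupp.single j 1 ≤ m := by
    rw [Finsupp.single_le_iff]; omega
  have hdeg : (m - Finsupp.single j 1).degree + 1 = m.degree := by
    conv_rhs => rw [← tsub_add_cancel_of_le hle]
    simp
  have hm' : m.degree ≤ p.totalDegree := le_totalDegree hm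
  change (m - Finsupp.single j 1).degree ≤ _
  omega

/-- At most `(n + 1) ^ d` monomials in `n` variables have degree at most `d`. -/
lemma exists_finset_degree_le_s14 [Fintype σ] (d : ℕ) :
    ∃ S : Finset (σ →₀ ℕ), S.card ≤ (Fintype.card σ + 1) ^ d ∧
      ∀ m : σ →₀ ℕ, m.degree ≤ d → m ∈ S := by
  classical
  induction d with
  | zero => exact ⟨{0}, by simp, fun m hm => by
      simpa [Finsupp.degree_eq_zero_iff] using hm⟩
  | succ d ih =>
    obtain ⟨S, hcard, hS⟩ := ih
    refine ⟨Finset.image₂ (fun m (o : Option σ) => m + o.elim 0 fun i => Finsupp.single i 1)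
      S Finset.univ, ?_, fun m hm => ?_⟩
    · refine (Finset.card_image₂_le _ _ _).trans ?_
      rw [Finset.card_univ, Fintype.card_option, pow_succ]
      gcongr
    · by_cases h0 : m = 0
      · exact Finset.mem_image₂.2 ⟨0, hS 0 (by simp), none, Finset.mem_univ _, by simp [h0]⟩
      obtain ⟨i, hi⟩ := Finsupp.ne_iff.1 h0
      have hle : Finsupp.single i 1 ≤ m := by
        rw [Finsupp.single_le_iff]
        exact Nat.one_le_iff_ne_zero.2 hi
      have hdeg : (m - Finsupp.single i 1).degree + 1 = m.degree := by
        conv_rhs => rw [← tsub_add_cancel_of_le hle]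
        simp
      exact Finset.mem_image₂.2 ⟨m - Finsupp.single i 1, hS _ (by omega), some i,
        Finset.mem_univ _, tsub_add_cancel_of_le hle⟩

lemma le_rpow_of_logb_natAbs_le {a : ℤ} {h : ℝ} (ha : Real.logb 2 (a.natAbs : ℝ) ≤ h) :
    |(a : ℝ)| ≤ (2 : ℝ) ^ h := by
  rcases eq_or_ne a 0 with rfl | h0
  · simpa using (Real.rpow_pos_of_pos two_pos h).le
  · have hcast : (a.natAbs : ℝ) = |(a : ℝ)| := by simp
    rw [hcast] at ha
    exact (Real.logb_le_iff_le_rpow one_lt_two (by simpa using h0)).1 ha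

lemma logb_natCast_nonneg (k : ℕ) : 0 ≤ Real.logb 2 (k : ℝ) :=
  div_nonneg (Real.log_natCast_nonneg k) (Real.log_nonneg one_le_two)

lemma abs_coeff_le_of_mvHeight_le {p : MvPolynomial σ ℤ} {h : ℝ} (hp : mvHeight p ≤ h)
    {m : σ →₀ ℕ} (hm : m ∈ p.support) : |((coeff m p : ℤ) : ℝ)| ≤ (2 : ℝ) ^ h := by
  refine le_rpow_of_logb_natAbs_le (le_trans ?_ hp)
  refine Real.logb_le_logb_of_le one_lt_two ?_ ?_
  · simpa using mem_support_iff.1 hm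
  · exact_mod_cast Finset.le_sup (f := fun m => (coeff m p).natAbs) hm

lemma coeffNorm_le_of_mvHeight_le [Fintype σ] {p : MvPolynomial σ ℤ} {d : ℕ} {h : ℝ}
    (hd : p.totalDegree ≤ d) (hp : mvHeight p ≤ h) :
    coeffNorm p ≤ ((Fintype.card σ : ℝ) + 1) ^ d * (2 : ℝ) ^ h := by
  obtain ⟨S, hcard, hS⟩ := exists_finset_degree_le_s14 (σ := σ) d
  have hsub : p.support ⊆ S := fun m hm => hS m ((le_totalDegree hm).trans hd)
  calc coeffNorm p ≤ p.support.card • (2 : ℝ) ^ h :=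
        Finset.sum_le_card_nsmul _ _ _ fun m hm => abs_coeff_le_of_mvHeight_le hp hm
    _ = (p.support.card : ℝ) * (2 : ℝ) ^ h := nsmul_eq_mul _ _
    _ ≤ _ := by
        gcongr
        exact_mod_cast (Finset.card_le_card hsub).trans hcard

lemma mvHeight_le_of_coeffNorm_le {p : MvPolynomial σ ℤ} {L : ℝ} (hL : 0 ≤ L)
    (hp : coeffNorm p ≤ (2 : ℝ) ^ L) : mvHeight p ≤ L := by
  rw [mvHeight]
  rcases Nat.eq_zero_or_pos (p.support.sup fun m => (coeff m p).natAbs) with h0 | hpos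
  · simpa [h0] using hL
  rw [Real.logb_le_iff_le_rpow one_lt_two (by exact_mod_cast hpos)]
  refine le_trans ?_ hp
  have hne : p.support.Nonempty := by
    rw [Finset.nonempty_iff_ne_empty]
    intro he
    simp [he] at hpos
  obtain ⟨m, hm, hmax⟩ := Finset.exists_mem_eq_sup _ hne fun m => (coeff m p).natAbs
  rw [hmax, Nat.cast_natAbs, Int.cast_abs]
  exact Finset.single_le_sum (f := fun m => |((coeff m p : ℤ) : ℝ)|) (fun _ _ => abs_nonneg _) hm

variable {ι : Type*} [Fintype ι] [DecidableEq ι]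

lemma coeffNorm_det_le (M : Matrix ι ι (MvPolynomial σ ℤ)) (b : ι → ℝ)
    (hb : ∀ i j, coeffNorm (M i j) ≤ b i) :
    coeffNorm M.det ≤ (Fintype.card ι).factorial * ∏ i, b i := by
  rw [Matrix.det_apply, ← Fintype.card_perm, ← Finset.card_univ, ← nsmul_eq_mul]
  refine (coeffNorm_sum_le _ _).trans (Finset.sum_le_card_nsmul _ _ _ fun τ _ => ?_)
  have hsign : coeffNorm (Equiv.Perm.sign τ • ∏ i, M (τ i) i) = coeffNorm (∏ i, M (τ i) i) := by
    rcases Int.units_eq_one_or (Equiv.Perm.sign τ) with hτ | hτ <;> simp [hτ, coeffNorm_neg]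
  rw [hsign, ← Equiv.prod_comp τ b]
  exact (coeffNorm_prod_le _ _).trans
    (Finset.prod_le_prod (fun _ _ => coeffNorm_nonneg _) fun i _ => hb _ _)

lemma totalDegree_det_le (M : Matrix ι ι (MvPolynomial σ ℤ)) (b : ι → ℕ)
    (hb : ∀ i j, (M i j).totalDegree ≤ b i) : M.det.totalDegree ≤ ∑ i, b i := by
  rw [Matrix.det_apply]
  refine totalDegree_finsetSum_le fun τ _ => ?_
  have hsign : (Equiv.Perm.sign τ • ∏ i, M (τ i) i).totalDegree =
      (∏ i, M (τ i) i).totalDegree := by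
    rcases Int.units_eq_one_or (Equiv.Perm.sign τ) with hτ | hτ <;> simp [hτ, totalDegree_neg]
  rw [hsign, ← Equiv.sum_comp τ b]
  exact (totalDegree_finsetProd _ _).trans (Finset.sum_le_sum fun i _ => hb _ _)

end CoeffNorm

lemma pderiv_sum_C_mul_X {n : ℕ} (c : Fin n → ℤ) (j : Fin n) :
    pderiv j (∑ k, C (c k) * X k : MvPolynomial (Fin n) ℤ) = C (c j) := by
  simp [pderiv_X, Pi.single_apply]

lemma prod_ite_val_lt {R : Type*} [CommMonoid R] {n s : ℕ} (hsn : s ≤ n) (a b : R) :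
    ∏ i : Fin n, (if (i : ℕ) < n - s then a else b) = a ^ (n - s) * b ^ s := by
  obtain ⟨k, rfl⟩ := Nat.exists_eq_add_of_le' hsn
  simp [Fin.prod_univ_add]

lemma sum_ite_val_lt {n s : ℕ} (hsn : s ≤ n) (b : ℕ) :
    ∑ i : Fin n, (if (i : ℕ) < n - s then 0 else b) = s * b := by
  obtain ⟨k, rfl⟩ := Nat.exists_eq_add_of_le' hsn
  simp [Fin.sum_univ_add]

/-- Lemma A.7 of the paper.  For `F₁, …, F_s ∈ ℤ[X₁, …, Xₙ]` of total
degree at most `d ≥ 2` and height at most `h`, and integers `λ_ij` of height at most `H`,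
the Jacobian determinant `J_s` of `Y₁, …, Y_{n−s}, F₁, …, F_s` (where
`Y_i = Σ_j λ_ij X_j`) with respect to `X₁, …, Xₙ` satisfies `deg J_s ≤ s(d − 1)` and
`h(J_s) ≤ s(log d + h) + (n − s)H + s·d·log(n+1) + log(n!)`. -/
theorem stmt_14 (n s : ℕ) (hsn : s ≤ n) (d : ℕ) (hd : 2 ≤ d) (h H : ℝ)
    (F : Fin s → MvPolynomial (Fin n) ℤ)
    (hdeg : ∀ i, (F i).totalDegree ≤ d)
    (hh : ∀ i, mvHeight (F i) ≤ h)
    (lam : Fin (n - s) → Fin n → ℤ)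
    (hlam : ∀ i j, Real.logb 2 (((lam i j).natAbs : ℝ)) ≤ H)
    (Y : Fin (n - s) → MvPolynomial (Fin n) ℤ)
    (hY : ∀ i, Y i = ∑ j : Fin n, MvPolynomial.C (lam i j) * MvPolynomial.X j)
    (M : Matrix (Fin n) (Fin n) (MvPolynomial (Fin n) ℤ))
    (hM : M = Matrix.of fun i j : Fin n =>
      if hi : (i : ℕ) < n - s then MvPolynomial.pderiv j (Y ⟨(i : ℕ), hi⟩)
      else MvPolynomial.pderiv j (F ⟨(i : ℕ) - (n - s), by have := i.2; omega⟩)) :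
    M.det.totalDegree ≤ s * (d - 1) ∧
    mvHeight M.det ≤
      (s : ℝ) * (Real.logb 2 (d : ℝ) + h) + ((n - s : ℕ) : ℝ) * H +
      (s : ℝ) * (d : ℝ) * Real.logb 2 ((n : ℝ) + 1) +
      Real.logb 2 ((Nat.factorial n : ℕ) : ℝ) := by
  have hentry_lin : ∀ i j : Fin n, (i : ℕ) < n - s →
      ∃ i', M i j = C (lam i' j) := fun i j hi =>
    ⟨⟨i, hi⟩, by rw [hM, Matrix.of_apply, dif_pos hi, hY, pderiv_sum_C_mul_X]⟩
  have hentry : ∀ i j : Fin n, ¬ (i : ℕ) < n - s → ∃ i', M i j = pderiv j (F i') :=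
    fun i j hi => ⟨_, by rw [hM, Matrix.of_apply, dif_neg hi]⟩
  constructor
  · rw [← sum_ite_val_lt hsn]
    refine totalDegree_det_le M _ fun i j => ?_
    split_ifs with hi
    · obtain ⟨i', hi'⟩ := hentry_lin i j hi
      rw [hi', totalDegree_C]
    · obtain ⟨i', hi'⟩ := hentry i j hi
      rw [hi']
      exact (totalDegree_pderiv_le _ _).trans (Nat.sub_le_sub_right (hdeg i') 1)
  have hd0 : (0 : ℝ) < d := by exact_mod_cast (by omega : 0 < d)
  have hh0 : 0 ≤ (s : ℝ) * h := by
    rcases Nat.eq_zero_or_pos s with rfl | hs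
    · simp
    · exact mul_nonneg s.cast_nonneg ((logb_natCast_nonneg _).trans (hh ⟨0, hs⟩))
  have hH0 : 0 ≤ ((n - s : ℕ) : ℝ) * H := by
    rcases Nat.eq_zero_or_pos (n - s) with hs | hs
    · simp [hs]
    · exact mul_nonneg (Nat.cast_nonneg _)
        ((logb_natCast_nonneg _).trans (hlam ⟨0, hs⟩ ⟨0, by omega⟩))
  have hlogn : 0 ≤ Real.logb 2 ((n : ℝ) + 1) := by exact_mod_cast logb_natCast_nonneg (n + 1)
  have hlogd := logb_natCast_nonneg d
  have hlogf := logb_natCast_nonneg n.factorial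
  refine mvHeight_le_of_coeffNorm_le ?_ ?_
  · rw [mul_add]
    positivity
  have hbound := coeffNorm_det_le M (fun i => if (i : ℕ) < n - s then (2 : ℝ) ^ H
      else d * (((n : ℝ) + 1) ^ d * (2 : ℝ) ^ h)) fun i j => by
    split_ifs with hi
    · obtain ⟨i', hi'⟩ := hentry_lin i j hi
      rw [hi']
      exact (coeffNorm_monomial _ _).trans_le (le_rpow_of_logb_natAbs_le (hlam i' j))
    · obtain ⟨i', hi'⟩ := hentry i j hi
      rw [hi']
      refine (coeffNorm_pderiv_le (hdeg i') j).trans ?_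
      gcongr
      simpa using coeffNorm_le_of_mvHeight_le (hdeg i') (hh i')
  rw [prod_ite_val_lt hsn, Fintype.card_fin] at hbound
  refine hbound.trans_eq ?_
  have hpow : ∀ (k : ℕ) (x : ℝ), (2 : ℝ) ^ ((k : ℝ) * x) = ((2 : ℝ) ^ x) ^ k := fun k x => by
    rw [mul_comm, Real.rpow_mul_natCast zero_le_two]
  have hexp : ∀ x : ℝ, 0 < x → (2 : ℝ) ^ Real.logb 2 x = x := fun x hx =>
    Real.rpow_logb two_pos (by norm_num) hx
  simp only [Real.rpow_add two_pos, mul_assoc, hpow]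
  rw [hexp _ hd0, hexp _ (by positivity), hexp _ (by exact_mod_cast n.factorial_pos)]
  ring
end
end
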